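/- arXiv:0708.2312 — 7 statements merged into one kernel-verified Lean document; each statement's English description precedes it below -/
import Mathlib

section
/- Let S be a nonempty proper subset of the set of cells I of an R×C table. Then B₀(S) (the set of basic moves that are moves for S) is a Markov basis for S if and only if neither S nor its complement Sᶜ exhibits pattern P or pattern Pᵗ. -/
open Finset

/-- A move for the subtable sum problem: all row sums and column sums are zero,
and the sum over the subtable `S` is zero. -/
def isMove {R C : ℕ} (S : Finset (Fin R × Fin C)) (z : Fin R × Fin C → ℤ) : Prop :=
  (∀ i : Fin R, ∑ j : Fin C, z (i, j) = 0) ∧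
  (∀ j : Fin C, ∑ i : Fin R, z (i, j) = 0) ∧
  (∑ p ∈ S, z p = 0)

/-- Two tables lie in the same `S`-fiber: equal row sums, column sums and `S`-sums. -/
def sameFiber {R C : ℕ} (S : Finset (Fin R × Fin C)) (x y : Fin R × Fin C → ℕ) : Prop :=
  (∀ i : Fin R, ∑ j : Fin C, x (i, j) = ∑ j : Fin C, y (i, j)) ∧
  (∀ j : Fin C, ∑ i : Fin R, x (i, j) = ∑ i : Fin R, y (i, j)) ∧
  (∑ p ∈ S, x p = ∑ p ∈ S, y p)

/-- The basic move `B(i,i';j,j')`: +1 at `(i,j)` and `(i',j')`, −1 at `(i,j')` and `(i',j)`. -/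
def basicMove {R C : ℕ} (i i' : Fin R) (j j' : Fin C) : Fin R × Fin C → ℤ := fun p =>
  (if p = (i, j) then 1 else 0) + (if p = (i', j') then 1 else 0)
    - (if p = (i, j') then 1 else 0) - (if p = (i', j) then 1 else 0)

/-- `B₀(S)`: the set of basic moves that are moves for `S`. -/
def B0 {R C : ℕ} (S : Finset (Fin R × Fin C)) : Set (Fin R × Fin C → ℤ) :=
  { z | ∃ i i' : Fin R, ∃ j j' : Fin C, i ≠ i' ∧ j ≠ j' ∧
      z = basicMove i i' j j' ∧ isMove S z }

/-- `ℬ` is a Markov basis for `S`: a finite, sign-invariant set of moves for `S` connecting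
any two distinct tables of a common `S`-fiber while staying nonnegative along the way. -/
def isMarkovBasis {R C : ℕ} (S : Finset (Fin R × Fin C))
    (ℬ : Set (Fin R × Fin C → ℤ)) : Prop :=
  ℬ.Finite ∧ (∀ z ∈ ℬ, isMove S z) ∧ (∀ z ∈ ℬ, -z ∈ ℬ) ∧
  ∀ x y : Fin R × Fin C → ℕ, sameFiber S x y → x ≠ y →
    ∃ (α : ℕ) (B : ℕ → (Fin R × Fin C → ℤ)),
      0 < α ∧ (∀ t < α, B t ∈ ℬ) ∧
      (∀ p, (y p : ℤ) = (x p : ℤ) + ∑ t ∈ Finset.range α, B t p) ∧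
      (∀ a, 1 ≤ a → a ≤ α → ∀ p, 0 ≤ (x p : ℤ) + ∑ t ∈ Finset.range a, B t p)

/-- `‖X − Y‖₁` can be reduced by `B₀(S)` (Definition 2 of the paper). -/
def normReducible {R C : ℕ} (S : Finset (Fin R × Fin C))
    (x y : Fin R × Fin C → ℕ) : Prop :=
  ∃ (τp τm : ℕ) (Bp Bm : ℕ → (Fin R × Fin C → ℤ)),
    0 < τp + τm ∧
    (∀ t < τp, Bp t ∈ B0 S) ∧ (∀ t < τm, Bm t ∈ B0 S) ∧
    (∀ a, 1 ≤ a → a ≤ τp → ∀ p, 0 ≤ (x p : ℤ) + ∑ t ∈ Finset.range a, Bp t p) ∧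
    (∀ a, 1 ≤ a → a ≤ τm → ∀ p, 0 ≤ (y p : ℤ) - ∑ t ∈ Finset.range a, Bm t p) ∧
    (∑ p : Fin R × Fin C,
        |(x p : ℤ) - (y p : ℤ) + ∑ t ∈ Finset.range τp, Bp t p
          + ∑ t ∈ Finset.range τm, Bm t p|)
      < ∑ p : Fin R × Fin C, |(x p : ℤ) - (y p : ℤ)|

/-- `T` exhibits pattern `P`. -/
def patternP {R C : ℕ} (T : Finset (Fin R × Fin C)) : Prop :=
  ∃ i₁ i₂ : Fin R, ∃ j₁ j₂ j₃ : Fin C,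
    i₁ ≠ i₂ ∧ j₁ ≠ j₂ ∧ j₁ ≠ j₃ ∧ j₂ ≠ j₃ ∧
    (i₁, j₁) ∈ T ∧ (i₂, j₂) ∈ T ∧
    (i₁, j₂) ∉ T ∧ (i₂, j₁) ∉ T ∧ (i₁, j₃) ∉ T ∧ (i₂, j₃) ∉ T

/-- `T` exhibits pattern `Pᵗ` (the transpose of pattern `P`). -/
def patternPt {R C : ℕ} (T : Finset (Fin R × Fin C)) : Prop :=
  ∃ i₁ i₂ i₃ : Fin R, ∃ j₁ j₂ : Fin C,
    i₁ ≠ i₂ ∧ i₁ ≠ i₃ ∧ i₂ ≠ i₃ ∧ j₁ ≠ j₂ ∧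
    (i₁, j₁) ∈ T ∧ (i₂, j₂) ∈ T ∧
    (i₂, j₁) ∉ T ∧ (i₁, j₂) ∉ T ∧ (i₃, j₁) ∉ T ∧ (i₃, j₂) ∉ T

/-- `S` is equivalent to a 2×2 block diagonal set. -/
def isBlockDiag {R C : ℕ} (S : Finset (Fin R × Fin C)) : Prop :=
  ∃ (R₁ : Finset (Fin R)) (C₁ : Finset (Fin C)),
    R₁.Nonempty ∧ R₁ ≠ Finset.univ ∧ C₁.Nonempty ∧ C₁ ≠ Finset.univ ∧
    S = R₁ ×ˢ C₁ ∪ R₁ᶜ ×ˢ C₁ᶜ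

/-- `S` is equivalent to a triangular set: its row slices are totally ordered by inclusion. -/
def isTriangular {R C : ℕ} (S : Finset (Fin R × Fin C)) : Prop :=
  ∀ i i' : Fin R,
    (∀ j : Fin C, (i, j) ∈ S → (i', j) ∈ S) ∨ (∀ j : Fin C, (i', j) ∈ S → (i, j) ∈ S)

/-- Two cells lie in the same block of `S`: equal row slices and equal column slices. -/
def sameBlock {R C : ℕ} (S : Finset (Fin R × Fin C)) (p q : Fin R × Fin C) : Prop :=
  (∀ j : Fin C, (p.1, j) ∈ S ↔ (q.1, j) ∈ S) ∧ (∀ i : Fin R, (i, p.2) ∈ S ↔ (i, q.2) ∈ S)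

/-- The `n × (n+1)` staircase set `{(i,j) : j ≤ i}` (with 1-based numbering), all of whose
blocks are single cells. -/
def staircase (n : ℕ) : Finset (Fin n × Fin (n + 1)) :=
  Finset.univ.filter (fun p => (p.2 : ℕ) ≤ (p.1 : ℕ))

/-- Condition (★) with threshold `i₀`: rows up to `i₀` are nonnegative at both boundary
columns, and rows after `i₀` are nonpositive there. -/
def starCond {n : ℕ} (z : Fin n × Fin (n + 1) → ℤ) (i₀ : Fin n) : Prop :=
  (∀ i : Fin n, i ≤ i₀ → 0 ≤ z (i, 0) ∧ 0 ≤ z (i, Fin.last n)) ∧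
  (∀ i : Fin n, i₀ < i → z (i, 0) ≤ 0 ∧ z (i, Fin.last n) ≤ 0)

/-- `i₁` is a last nonzero boundary row of `z`. -/
def lastBoundaryRow {n : ℕ} (z : Fin n × Fin (n + 1) → ℤ) (i₁ : Fin n) : Prop :=
  z (i₁, 0) ≤ 0 ∧ z (i₁, Fin.last n) ≤ 0 ∧
  (z (i₁, 0) < 0 ∨ z (i₁, Fin.last n) < 0) ∧
  (∀ i : Fin n, i₁ < i → z (i, 0) = 0 ∧ z (i, Fin.last n) = 0)

set_option linter.unusedSectionVars false

section Aux

variable {ι κ : Type} [Fintype ι] [Fintype κ] [DecidableEq ι] [DecidableEq κ]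

/-- Basic move in product form. -/
def bm (i i' : ι) (j j' : κ) (p : ι) (q : κ) : ℤ :=
  ((if p = i then 1 else 0) - (if p = i' then 1 else 0)) *
    ((if q = j then 1 else 0) - (if q = j' then 1 else 0))

/-- One (possibly trivial) basic step. -/
def Step (w : ι → κ → ℤ) (x y : ι → κ → ℕ) : Prop :=
  ∃ i i' j j', w i j + w i' j' = w i j' + w i' j ∧
    ∀ p q, (y p q : ℤ) = x p q + bm i i' j j' p q

/-- Connectedness by basic steps. -/
def Conn (w : ι → κ → ℤ) : (ι → κ → ℕ) → (ι → κ → ℕ) → Prop :=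
  Relation.ReflTransGen (Step w)

/-- Same fiber. -/
structure Fib (w : ι → κ → ℤ) (x y : ι → κ → ℕ) : Prop where
  row : ∀ i, ∑ j, (x i j : ℤ) = ∑ j, (y i j : ℤ)
  col : ∀ j, ∑ i, (x i j : ℤ) = ∑ i, (y i j : ℤ)
  hit : ∑ i, ∑ j, w i j * (x i j : ℤ) = ∑ i, ∑ j, w i j * (y i j : ℤ)

lemma Fib.symm {w : ι → κ → ℤ} {x y : ι → κ → ℕ} (h : Fib w x y) : Fib w y x :=
  ⟨fun i => (h.row i).symm, fun j => (h.col j).symm, h.hit.symm⟩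

lemma Fib.trans {w : ι → κ → ℤ} {x y z : ι → κ → ℕ} (h : Fib w x y) (h' : Fib w y z) :
    Fib w x z :=
  ⟨fun i => (h.row i).trans (h'.row i), fun j => (h.col j).trans (h'.col j),
    h.hit.trans h'.hit⟩

lemma sum_bm_hit (w : ι → κ → ℤ) (i i' : ι) (j j' : κ) :
    ∑ p, ∑ q, w p q * bm i i' j j' p q = w i j + w i' j' - w i j' - w i' j := by
  have : ∀ p q, w p q * bm i i' j j' p q =
      (if p = i then (if q = j then w p q else 0) else 0)
      + (if p = i' then (if q = j' then w p q else 0) else 0)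
      - (if p = i then (if q = j' then w p q else 0) else 0)
      - (if p = i' then (if q = j then w p q else 0) else 0) := by
    intro p q
    unfold bm
    split_ifs <;> ring
  simp only [this, Finset.sum_add_distrib, Finset.sum_sub_distrib]
  have e : ∀ (a : ι) (b : κ), ∑ p, ∑ q, (if p = a then (if q = b then w p q else 0) else 0)
      = w a b := by
    intro a b
    rw [Finset.sum_eq_single a]
    · simp
    · intro p _ hp; simp [hp]
    · simp
  simp only [e]

lemma Step.fib {w : ι → κ → ℤ} {x y : ι → κ → ℕ} (h : Step w x y) : Fib w x y := by
  obtain ⟨i, i', j, j', hb, he⟩ := h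
  refine ⟨fun p => ?_, fun q => ?_, ?_⟩
  · simp only [he, Finset.sum_add_distrib, bm, ← Finset.mul_sum, Finset.sum_sub_distrib]
    simp
  · simp only [he, Finset.sum_add_distrib, bm, ← Finset.sum_mul, Finset.sum_sub_distrib]
    simp
  · simp only [he, mul_add, Finset.sum_add_distrib, sum_bm_hit]
    omega

lemma Conn.fib {w : ι → κ → ℤ} {x y : ι → κ → ℕ} (h : Conn w x y) : Fib w x y := by
  induction h with
  | refl => exact ⟨fun _ => rfl, fun _ => rfl, rfl⟩
  | tail _ h2 ih => exact ih.trans h2.fib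

lemma Step.symm {w : ι → κ → ℤ} {x y : ι → κ → ℕ} (h : Step w x y) : Step w y x := by
  obtain ⟨i, i', j, j', hb, he⟩ := h
  refine ⟨i', i, j, j', by omega, fun p q => ?_⟩
  rw [he p q]; unfold bm; ring

lemma Conn.symm {w : ι → κ → ℤ} {x y : ι → κ → ℕ} (h : Conn w x y) : Conn w y x := by
  induction h with
  | refl => exact Relation.ReflTransGen.refl
  | tail _ h2 ih => exact Relation.ReflTransGen.head h2.symm ih

lemma Conn.trans {w : ι → κ → ℤ} {x y z : ι → κ → ℕ} (h : Conn w x y) (h' : Conn w y z) :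
    Conn w x z := Relation.ReflTransGen.trans h h'

lemma Conn.add {w : ι → κ → ℤ} {x y : ι → κ → ℕ} (e : ι → κ → ℕ) (h : Conn w x y) :
    Conn w (fun p q => x p q + e p q) (fun p q => y p q + e p q) := by
  induction h with
  | refl => exact Relation.ReflTransGen.refl
  | tail _ h2 ih =>
    refine Relation.ReflTransGen.tail ih ?_
    obtain ⟨i, i', j, j', hb, he⟩ := h2
    refine ⟨i, i', j, j', hb, fun p q => ?_⟩
    push_cast
    rw [he p q]; ring

lemma Conn.flip {w : ι → κ → ℤ} {x y : κ → ι → ℕ}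
    (h : Conn (fun j i => 1 - w i j) x y) :
    Conn w (fun i j => x j i) (fun i j => y j i) := by
  induction h with
  | refl => exact Relation.ReflTransGen.refl
  | tail _ h2 ih =>
    refine Relation.ReflTransGen.tail ih ?_
    obtain ⟨i, i', j, j', hb, he⟩ := h2
    dsimp only at hb
    refine ⟨j, j', i, i', by omega, fun p q => ?_⟩
    rw [he q p]; unfold bm; ring

lemma swap {w : ι → κ → ℤ} {x : ι → κ → ℕ} {i i' : ι} {j j' : κ}
    (h1 : 0 < x i j) (h2 : 0 < x i' j') (hb : w i j + w i' j' = w i j' + w i' j) :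
    ∃ y, Conn w x y ∧ 0 < y i j' ∧ 0 < y i' j ∧
      ∀ p q, (p, q) ≠ (i, j) → (p, q) ≠ (i', j') → x p q ≤ y p q := by
  have hn : ∀ p q, 0 ≤ (x p q : ℤ) + bm i i' j' j p q := by
    intro p q
    by_cases e1 : p = i ∧ q = j
    · obtain ⟨rfl, rfl⟩ := e1
      unfold bm; split_ifs <;> simp <;> omega
    · by_cases e2 : p = i' ∧ q = j'
      · obtain ⟨rfl, rfl⟩ := e2
        unfold bm; split_ifs <;> simp <;> omega
      · have : 0 ≤ bm i i' j' j p q := by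
          unfold bm; split_ifs <;> simp_all
        omega
  have hy : ∀ p q, ((((x p q : ℤ) + bm i i' j' j p q).toNat : ℕ) : ℤ)
      = x p q + bm i i' j' j p q := fun p q => Int.toNat_of_nonneg (hn p q)
  refine ⟨fun p q => ((x p q : ℤ) + bm i i' j' j p q).toNat,
    Relation.ReflTransGen.single ⟨i, i', j', j, by omega, hy⟩, ?_, ?_, ?_⟩
  · have := hy i j'
    by_cases e1 : i = i'
    · subst e1; simp [bm] at this ⊢; omega
    · by_cases e2 : j' = j
      · subst e2; simp [bm] at this ⊢; omega
      · simp [bm, e1, e2] at this ⊢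
  · have := hy i' j
    by_cases e1 : i' = i
    · subst e1; simp [bm] at this ⊢; omega
    · by_cases e2 : j = j'
      · subst e2; simp [bm] at this ⊢; omega
      · simp [bm, e1, e2] at this ⊢
  · intro p q n1 n2
    have : 0 ≤ bm i i' j' j p q := by
      unfold bm; split_ifs <;> simp_all
    have := hy p q
    zify
    rw [this]; omega

lemma Fib.exists_row {w : ι → κ → ℤ} {x y : ι → κ → ℕ} (h : Fib w x y) {i : ι} {j : κ}
    (hx : 0 < x i j) : ∃ j', 0 < y i j' := by
  by_contra! hc
  have h1 : ∑ j, (x i j : ℤ) = 0 := by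
    rw [h.row i]; exact Finset.sum_eq_zero fun j _ => by have := hc j; omega
  have := (Finset.sum_eq_zero_iff_of_nonneg (fun j _ => by positivity)).1 h1 j (mem_univ _)
  omega

lemma Fib.exists_col {w : ι → κ → ℤ} {x y : ι → κ → ℕ} (h : Fib w x y) {i : ι} {j : κ}
    (hx : 0 < x i j) : ∃ i', 0 < y i' j := by
  by_contra! hc
  have h1 : ∑ i, (x i j : ℤ) = 0 := by
    rw [h.col j]; exact Finset.sum_eq_zero fun j _ => by have := hc j; omega
  have := (Finset.sum_eq_zero_iff_of_nonneg (fun j _ => by positivity)).1 h1 i (mem_univ _)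
  omega

lemma core {w : ι → κ → ℤ} (h01 : ∀ i j, w i j = 0 ∨ w i j = 1) {h : κ → ℤ}
    (hm : ∀ i j j', h j' ≤ h j → w i j' ≤ w i j) {x y : ι → κ → ℕ} (hf : Fib w x y)
    {r : ι} (hr : ∀ i e, 0 < x i e → w r e = 0) {a c : κ} (hac : h c < h a)
    (hxa : 0 < x r a) (hyc : 0 < y r c)
    (X : ∀ x' e, Conn w x x' → 0 < x' r e → ¬ (h c ≤ h e ∧ h e < h a))
    (Y : ∀ y' e, Conn w y y' → 0 < y' r e → ¬ (h c < h e ∧ h e ≤ h a)) : False := by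
  have hrx : ∀ x' i e, Conn w x x' → 0 < x' i e → w r e = 0 := by
    intro x' i e hc hp
    obtain ⟨i', hi'⟩ := hc.fib.symm.exists_col hp
    exact hr i' e hi'
  have hry : ∀ x' i e, Conn w y x' → 0 < x' i e → w r e = 0 := by
    intro x' i e hc hp
    obtain ⟨i', hi'⟩ := (hf.trans hc.fib).symm.exists_col hp
    exact hr i' e hi'
  have hra := hr r a hxa
  have hrc := hry y r c Relation.ReflTransGen.refl hyc
  have X1 : ∀ x' i e, Conn w x x' → 0 < x' r a → 0 < x' i e → h c ≤ h e → h e < h a →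
      w i a = 1 ∧ w i e = 0 := by
    intro x' i e hx' h1 h2 h3 h4
    have := hm i a e h4.le
    have := hrx x' i e hx' h2
    by_contra hcon
    obtain ⟨z, hz, hz1, -⟩ := swap (w := w) h1 h2 (by
      have := h01 i a
      have := h01 i e
      omega)
    exact X z e (hx'.trans hz) hz1 ⟨h3, h4⟩
  have Y1 : ∀ y' i e, Conn w y y' → 0 < y' r c → 0 < y' i e → h c < h e → h e ≤ h a →
      w i e = 1 ∧ w i c = 0 := by
    intro x' i e hx' h1 h2 h3 h4
    have := hm i e c h3.le
    have := hry x' i e hx' h2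
    by_contra hcon
    obtain ⟨z, hz, hz1, -⟩ := swap (w := w) h1 h2 (by
      have := h01 i c
      have := h01 i e
      omega)
    exact Y z e (hx'.trans hz) hz1 ⟨h3, h4⟩
  obtain ⟨i0, hi0⟩ := hf.symm.exists_col hyc
  obtain ⟨i1, hi1⟩ := hf.exists_col hxa
  have hi0' := X1 x i0 c Relation.ReflTransGen.refl hxa hi0 le_rfl hac
  have hi1' := Y1 y i1 a Relation.ReflTransGen.refl hyc hi1 hac le_rfl
  have bx : ∀ i e, 0 < x i e → w i e + (1 - w i a) ≤ if h a ≤ h e then 1 else 0 := by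
    intro i e hp
    have hb := X1 x i e Relation.ReflTransGen.refl hxa hp
    have k1 := hm i a c hac.le
    have k2 := h01 i a
    have k3 := h01 i e
    have k4 := h01 i c
    have k5 := h01 i0 e
    rcases k2 with hL | hL
    · have hne : w i e ≠ w i0 e := by
        intro heq
        have hne' : ¬ (r = i ∧ a = e) := by
          rintro ⟨rfl, rfl⟩; omega
        have hne2 : ¬ (r = i0 ∧ a = c) := by
          rintro ⟨rfl, rfl⟩; omega
        obtain ⟨z, hz, hz1, hz2, hz3⟩ := swap (w := w) hp hi0 (by omega)
        have := hz3 r a (by simpa using hne') (by simpa using hne2)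
        have := X1 z i c hz (by omega) hz1 le_rfl hac
        omega
      have k6 : w i e = 1 → h a < h e := by
        intro h1; by_contra hcon
        have := hm i a e (by omega); omega
      have k7 := hm i0 e a
      have k8 : w i0 e = 1 → h c < h e := by
        intro h1; by_contra hcon
        have := hm i0 c e (by omega); omega
      split_ifs <;> omega
    · by_cases h1 : h a ≤ h e
      · rw [if_pos h1]; omega
      · rw [if_neg h1]
        by_cases h2 : h c ≤ h e
        · omega
        · by_contra hcon
          have m1 := hm i c e (by omega)
          have m2 := hm i0 c e (by omega)
          have hne' : ¬ (r = i ∧ a = e) := by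
            rintro ⟨rfl, rfl⟩; omega
          have hne2 : ¬ (r = i0 ∧ a = c) := by
            rintro ⟨rfl, rfl⟩; omega
          obtain ⟨z, hz, hz1, hz2, hz3⟩ := swap (w := w) hp hi0 (by omega)
          have := hz3 r a (by simpa using hne') (by simpa using hne2)
          have := X1 z i c hz (by omega) hz1 le_rfl hac
          omega
  have bY : ∀ i e, 0 < y i e → (if h a ≤ h e then 1 else 0) ≤ w i e := by
    intro i e hp
    have k3 := h01 i e
    have k2 := h01 i a
    by_cases h1 : h a ≤ h e
    · rw [if_pos h1]
      by_contra hcon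
      have m1 := hm i e a h1
      have m2 := hm i1 e a h1
      have m3 := h01 i1 e
      have hne' : ¬ (r = i ∧ c = e) := by
        rintro ⟨rfl, rfl⟩; omega
      have hne2 : ¬ (r = i1 ∧ c = a) := by
        rintro ⟨rfl, rfl⟩; omega
      obtain ⟨z, hz, hz1, hz2, hz3⟩ := swap (w := w) hp hi1 (by omega)
      have := hz3 r c (by simpa using hne') (by simpa using hne2)
      have := Y1 z i a hz (by omega) hz1 hac le_rfl
      omega
    · rw [if_neg h1]; omega
  set g : κ → ℤ := fun e => if h a ≤ h e then 1 else 0 with hg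
  have s1 : ∑ i, ∑ e, w i e * (x i e : ℤ) + ∑ i, ∑ e, (1 - w i a) * (x i e : ℤ)
      ≤ ∑ i, ∑ e, g e * (x i e : ℤ) := by
    simp only [← Finset.sum_add_distrib]
    refine Finset.sum_le_sum fun i _ => Finset.sum_le_sum fun e _ => ?_
    rw [← add_mul]
    rcases Nat.eq_zero_or_pos (x i e) with h0 | h0
    · simp [h0]
    · exact mul_le_mul_of_nonneg_right (bx i e h0) (by positivity)
  have s2 : ∑ i, ∑ e, g e * (y i e : ℤ) ≤ ∑ i, ∑ e, w i e * (y i e : ℤ) := by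
    refine Finset.sum_le_sum fun i _ => Finset.sum_le_sum fun e _ => ?_
    rcases Nat.eq_zero_or_pos (y i e) with h0 | h0
    · simp [h0]
    · exact mul_le_mul_of_nonneg_right (bY i e h0) (by positivity)
  have s3 : ∑ i, ∑ e, g e * (x i e : ℤ) = ∑ i, ∑ e, g e * (y i e : ℤ) := by
    rw [Finset.sum_comm, Finset.sum_comm (f := fun i e => g e * (y i e : ℤ))]
    simp only [← Finset.mul_sum, hf.col]
  have nn : ∀ i e, 0 ≤ (1 - w i a) * (x i e : ℤ) := fun i e =>
    mul_nonneg (by have := h01 i a; omega) (by positivity)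
  have s4 : 1 ≤ ∑ i, ∑ e, (1 - w i a) * (x i e : ℤ) := by
    calc (1 : ℤ) ≤ (1 - w r a) * (x r a : ℤ) := by rw [hra]; omega
      _ ≤ ∑ e, (1 - w r a) * (x r e : ℤ) :=
        Finset.single_le_sum (f := fun e => (1 - w r a) * (x r e : ℤ))
          (fun e _ => nn r e) (mem_univ a)
      _ ≤ _ := Finset.single_le_sum (f := fun i => ∑ e, (1 - w i a) * (x i e : ℤ))
          (fun i _ => Finset.sum_nonneg fun e _ => nn i e) (mem_univ r)
  have := hf.hit
  omega

/-- the tables can be moved so as to share a cell. -/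
def Common (w : ι → κ → ℤ) (x y : ι → κ → ℕ) : Prop :=
  ∃ x' y' p q, Conn w x x' ∧ Conn w y y' ∧ 0 < x' p q ∧ 0 < y' p q

lemma common_row {w : ι → κ → ℤ} (h01 : ∀ i j, w i j = 0 ∨ w i j = 1) {h : κ → ℤ}
    (hm : ∀ i j j', h j' ≤ h j → w i j' ≤ w i j) {x y : ι → κ → ℕ} (hf : Fib w x y)
    {r : ι} (hr : ∀ i e, 0 < x i e → w r e = 0) {a : κ} (hxa : 0 < x r a) :
    Common w x y := by
  classical
  let Q : ℕ → Prop := fun n => ∃ x' y' a c, Conn w x x' ∧ Conn w y y' ∧ 0 < x' r a ∧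
    0 < y' r c ∧ n = (h a - h c).natAbs
  have hQ : ∃ n, Q n := by
    obtain ⟨c, hc⟩ := hf.exists_row hxa
    exact ⟨_, x, y, a, c, Relation.ReflTransGen.refl, Relation.ReflTransGen.refl, hxa, hc, rfl⟩
  have hmin : ∀ x' y' a c, Conn w x x' → Conn w y y' → 0 < x' r a →
    0 < y' r c → Nat.find hQ ≤ (h a - h c).natAbs := fun x' y' a c h1 h2 h3 h4 =>
      Nat.find_min' hQ ⟨x', y', a, c, h1, h2, h3, h4, rfl⟩
  obtain ⟨x', y', a, c, cx, cy, xa, yc, he⟩ := Nat.find_spec hQ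
  rw [he] at hmin
  have hf' : Fib w x' y' := (cx.fib.symm.trans hf).trans cy.fib
  have hr' : ∀ i e, 0 < x' i e → w r e = 0 := by
    intro i e hp
    obtain ⟨i', hi'⟩ := cx.fib.symm.exists_col hp
    exact hr i' e hi'
  have hry' : ∀ i e, 0 < y' i e → w r e = 0 := by
    intro i e hp
    obtain ⟨i', hi'⟩ := hf'.symm.exists_col hp
    exact hr' i' e hi'
  rcases lt_trichotomy (h a) (h c) with hlt | heq | hlt
  · exfalso
    refine core h01 hm hf'.symm hry' hlt yc xa ?_ ?_
    · intro z e hz hp hcon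
      have := hmin x' z a e cx (cy.trans hz) xa hp
      omega
    · intro z e hz hp hcon
      have := hmin z y' e c (cx.trans hz) cy hp yc
      omega
  · obtain ⟨i, hi⟩ := hf'.symm.exists_col yc
    have e1 := hm i a c heq.ge
    have e2 := hm i c a heq.le
    have e3 := hm r a c heq.ge
    have e4 := hm r c a heq.le
    obtain ⟨z, hz, hz1, -⟩ := swap (w := w) xa hi (by omega)
    exact ⟨z, y', r, c, cx.trans hz, cy, hz1, yc⟩
  · exfalso
    refine core h01 hm hf' hr' hlt xa yc ?_ ?_
    · intro z e hz hp hcon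
      have := hmin z y' e c (cx.trans hz) cy hp yc
      omega
    · intro z e hz hp hcon
      have := hmin x' z a e cx (cy.trans hz) xa hp
      omega

/-- no diagonal 2×2 pattern -/
def Nested (w : ι → κ → ℤ) : Prop :=
  ∀ i i' j j', ¬ (w i j = 1 ∧ w i j' = 0 ∧ w i' j = 0 ∧ w i' j' = 1)


lemma Nested.mono {w : ι → κ → ℤ} (h01 : ∀ i j, w i j = 0 ∨ w i j = 1) (hn : Nested w) :
    ∀ i j j', ∑ i, w i j' ≤ ∑ i, w i j → w i j' ≤ w i j := by
  intro i j j' hle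
  by_contra hcon
  refine absurd hle (not_le.2 ?_)
  refine Finset.sum_lt_sum (fun p _ => ?_) ⟨i, mem_univ _, by omega⟩
  have := hn p i j j'
  have := h01 p j
  have := h01 p j'
  have := h01 i j
  have := h01 i j'
  omega

lemma common_nested {w : ι → κ → ℤ} (h01 : ∀ i j, w i j = 0 ∨ w i j = 1) (hn : Nested w)
    {x y : ι → κ → ℕ} (hf : Fib w x y) (hx : ∃ i j, 0 < x i j) : Common w x y := by
  classical
  have hm := hn.mono h01
  let A : Finset κ := univ.filter fun j => ∃ i, 0 < x i j
  have hA : A.Nonempty := by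
    obtain ⟨i, j, hp⟩ := hx
    exact ⟨j, by simp [A]; exact ⟨i, hp⟩⟩
  obtain ⟨j0, hj0, hmax⟩ := Finset.exists_max_image A (fun j => ∑ i, w i j) hA
  by_cases hfull : ∀ i e, 0 < x i e → w i j0 = 1
  · obtain ⟨i, hi⟩ : ∃ i, 0 < x i j0 := by simpa [A] using hj0
    have h01' : ∀ j i, (fun j i => 1 - w i j) j i = 0 ∨ (fun j i => 1 - w i j) j i = 1 := by
      intro j i; have := h01 i j; dsimp only; omega
    have hn' : Nested (fun j i => 1 - w i j) := by
      intro j j' i i' hh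
      dsimp only at hh
      have := hn i i' j' j
      omega
    have tot : ∀ x : ι → κ → ℕ, ∑ j, ∑ i, (1 - w i j) * (x i j : ℤ) =
        ∑ j, ∑ i, (x i j : ℤ) - ∑ i, ∑ j, w i j * (x i j : ℤ) := by
      intro x
      rw [Finset.sum_comm (f := fun i j => w i j * (x i j : ℤ)), ← Finset.sum_sub_distrib]
      refine Finset.sum_congr rfl fun j _ => ?_
      rw [← Finset.sum_sub_distrib]
      exact Finset.sum_congr rfl fun i _ => by ring
    have hf' : Fib (fun j i => 1 - w i j) (fun j i => x i j) (fun j i => y i j) := by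
      refine ⟨hf.col, hf.row, ?_⟩
      rw [tot, tot, hf.hit]
      simp only [hf.col]
    obtain ⟨x', y', p, q, c1, c2, p1, p2⟩ := common_row h01' (hn'.mono h01') hf' (r := j0)
      (fun e i hp => by have := hfull i e hp; omega) (a := i) hi
    exact ⟨_, _, q, p, c1.flip, c2.flip, p1, p2⟩
  · push Not at hfull
    obtain ⟨r, e, hp, hne⟩ := hfull
    refine common_row h01 hm hf (r := r) (fun i' e' hp' => ?_) hp
    have := hm r j0 e' (hmax e' (by simp [A]; exact ⟨i', hp'⟩))
    have := h01 r j0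
    have := h01 r e'
    omega

lemma common_block {w : ι → κ → ℤ} {f : ι → ℤ} {g : κ → ℤ} (hf1 : ∀ i, f i = 1 ∨ f i = -1)
    (hg1 : ∀ j, g j = 1 ∨ g j = -1) (hw : ∀ i j, 2 * w i j = 1 + f i * g j)
    {x y : ι → κ → ℕ} (hf : Fib w x y) (hx : ∃ i j, 0 < x i j) : Common w x y := by
  obtain ⟨i, j, hp⟩ := hx
  have exY : ∃ i2 j2, 0 < y i2 j2 ∧ f i2 = f i ∧ g j2 = g j := by
    by_contra! hcon
    -- weight (1 + f i * f p) * (1 + g j * g q) is nonneg and supported on the block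
    have expand : ∀ x : ι → κ → ℕ,
        ∑ p, ∑ q, ((1 + f i * f p) * (1 + g j * g q)) * (x p q : ℤ) =
        ∑ p, (1 + f i * f p - f i * g j) * ∑ q, (x p q : ℤ)
          + ∑ q, (g j * g q) * ∑ p, (x p q : ℤ)
          + 2 * (f i * g j) * ∑ p, ∑ q, w p q * (x p q : ℤ) := by
      intro x
      simp only [Finset.mul_sum]
      rw [Finset.sum_comm (f := fun q p => g j * g q * (x p q : ℤ))]
      simp only [← Finset.sum_add_distrib]
      refine Finset.sum_congr rfl fun p _ => Finset.sum_congr rfl fun q _ => ?_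
      linear_combination (-(f i * g j) * (x p q : ℤ)) * hw p q
    have e1 := expand x
    have e2 := expand y
    rw [hf.hit] at e1
    simp only [hf.row, hf.col] at e1
    rw [← e2] at e1
    have z2 : ∑ p, ∑ q, ((1 + f i * f p) * (1 + g j * g q)) * (y p q : ℤ) = 0 := by
      refine Finset.sum_eq_zero fun p _ => Finset.sum_eq_zero fun q _ => ?_
      rcases Nat.eq_zero_or_pos (y p q) with h0 | h0
      · simp [h0]
      · have := hcon p q h0
        rcases hf1 i with a1 | a1 <;> rcases hf1 p with a2 | a2 <;>
        rcases hg1 j with a3 | a3 <;> rcases hg1 q with a4 | a4 <;>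
        simp [a1, a2, a3, a4] at this ⊢
    rw [z2] at e1
    have nn : ∀ p q, 0 ≤ ((1 + f i * f p) * (1 + g j * g q)) * (x p q : ℤ) := by
      intro p q
      refine mul_nonneg (mul_nonneg ?_ ?_) (by positivity)
      · rcases hf1 i with a1 | a1 <;> rcases hf1 p with a2 | a2 <;> simp [a1, a2]
      · rcases hg1 j with a3 | a3 <;> rcases hg1 q with a4 | a4 <;> simp [a3, a4]
    have h1 := (Finset.sum_eq_zero_iff_of_nonneg
      (fun p _ => Finset.sum_nonneg fun q _ => nn p q)).1 e1 i (mem_univ _)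
    have h2 := (Finset.sum_eq_zero_iff_of_nonneg (fun q _ => nn i q)).1 h1 j (mem_univ _)
    have q1 : f i * f i = 1 := by rcases hf1 i with a | a <;> simp [a]
    have q2 : g j * g j = 1 := by rcases hg1 j with a | a <;> simp [a]
    rw [q1, q2] at h2
    omega
  obtain ⟨i2, j2, hy2, hi2, hj2⟩ := exY
  have wr : ∀ e, w i2 e = w i e := fun e => by
    have h1 := hw i2 e; have h2 := hw i e; rw [hi2] at h1; omega
  have wc : ∀ p, w p j2 = w p j := fun p => by
    have h1 := hw p j2; have h2 := hw p j; rw [hj2] at h1; omega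
  obtain ⟨j3, hj3⟩ := hf.exists_row hp
  obtain ⟨z, hz, hz1, -⟩ := swap (w := w) hj3 hy2 (by simp only [wr]; ring)
  obtain ⟨i4, hi4⟩ := (hf.trans hz.fib).exists_col hp
  obtain ⟨u, hu, hu1, -⟩ := swap (w := w) hz1 hi4 (by simp only [wc])
  exact ⟨x, u, i, j, Relation.ReflTransGen.refl, hz.trans hu, hp, hu1⟩

lemma connected {w : ι → κ → ℤ}
    (hC : ∀ x y : ι → κ → ℕ, Fib w x y → (∃ i j, 0 < x i j) → Common w x y) :
    ∀ (n : ℕ) (x y : ι → κ → ℕ), Fib w x y → ∑ i, ∑ j, (x i j : ℤ) = n → Conn w x y := by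
  intro n
  induction n with
  | zero =>
    intro x y hf h0
    have key : ∀ x : ι → κ → ℕ, ∑ i, ∑ j, (x i j : ℤ) = 0 → x = fun _ _ => 0 := by
      intro x h0
      funext i j
      have h1 := (Finset.sum_eq_zero_iff_of_nonneg
        (fun p _ => Finset.sum_nonneg fun q _ => by positivity)).1 h0 i (mem_univ _)
      have h2 := (Finset.sum_eq_zero_iff_of_nonneg (fun q _ => by positivity)).1 h1 j (mem_univ _)
      omega
    have h1 : ∑ i, ∑ j, (y i j : ℤ) = 0 := by
      simp only [← hf.row]; simpa using h0
    rw [key x (by simpa using h0), key y h1]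
    exact Relation.ReflTransGen.refl
  | succ n ih =>
    intro x y hf h0
    have hpos : ∃ i j, 0 < x i j := by
      by_contra! hcon
      have : ∑ i, ∑ j, (x i j : ℤ) = 0 :=
        Finset.sum_eq_zero fun i _ => Finset.sum_eq_zero fun j _ => by have := hcon i j; omega
      omega
    obtain ⟨x', y', p, q, cx, cy, px, py⟩ := hC x y hf hpos
    have hf' : Fib w x' y' := (cx.fib.symm.trans hf).trans cy.fib
    let e : ι → κ → ℕ := fun i j => if i = p then (if j = q then 1 else 0) else 0
    have sub : ∀ z : ι → κ → ℕ, 0 < z p q → ∃ u : ι → κ → ℕ, z = fun i j => u i j + e i j := by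
      intro z hz
      refine ⟨fun i j => z i j - e i j, ?_⟩
      funext i j
      dsimp only [e]
      split_ifs with h1 h2
      · subst h1 h2; omega
      · omega
      · omega
    obtain ⟨u, rfl⟩ := sub x' px
    obtain ⟨v, rfl⟩ := sub y' py
    have hfu : Fib w u v := by
      refine ⟨fun i => ?_, fun j => ?_, ?_⟩
      · have := hf'.row i
        push_cast at this
        simp only [Finset.sum_add_distrib] at this
        omega
      · have := hf'.col j
        push_cast at this
        simp only [Finset.sum_add_distrib] at this
        omega
      · have := hf'.hit
        push_cast at this
        simp only [mul_add, Finset.sum_add_distrib] at this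
        omega
    have hsum : ∑ i, ∑ j, (u i j : ℤ) = n := by
      have h1 : ∑ i, ∑ j, ((u i j + e i j : ℕ) : ℤ) = (n : ℤ) + 1 := by
        have := h0
        simp only [cx.fib.row] at this
        simpa using this
      push_cast at h1
      simp only [Finset.sum_add_distrib] at h1
      have h2 : ∑ i, ∑ j, (e i j : ℤ) = 1 := by
        rw [Finset.sum_eq_single p]
        · simp [e]
        · intro i _ hi; simp [e, hi]
        · simp
      omega
    exact (cx.trans ((ih u v hfu hsum).add e)).trans cy.symm

end Aux

section Final

variable {R C : ℕ}

/-- indicator of `S` -/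
def ind (S : Finset (Fin R × Fin C)) (i : Fin R) (j : Fin C) : ℤ := if (i, j) ∈ S then 1 else 0

lemma ind01 (S : Finset (Fin R × Fin C)) (i : Fin R) (j : Fin C) :
    ind S i j = 0 ∨ ind S i j = 1 := by
  unfold ind; split_ifs <;> simp

lemma sum_ind (S : Finset (Fin R × Fin C)) (z : Fin R × Fin C → ℤ) :
    ∑ p ∈ S, z p = ∑ i, ∑ j, ind S i j * z (i, j) := by
  rw [← Fintype.sum_prod_type' (f := fun i j => ind S i j * z (i, j))]
  simp [ind]

lemma basicMove_eq {i i' : Fin R} {j j' : Fin C} (hi : i ≠ i') (hj : j ≠ j') (p : Fin R)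
    (q : Fin C) : basicMove i i' j j' (p, q) = bm i i' j j' p q := by
  unfold basicMove bm
  simp only [Prod.mk.injEq]
  by_cases h1 : p = i <;> by_cases h2 : p = i' <;> by_cases h3 : q = j <;>
    by_cases h4 : q = j' <;> simp_all

lemma isMove_basic (S : Finset (Fin R × Fin C)) {i i' : Fin R} {j j' : Fin C}
    (hi : i ≠ i') (hj : j ≠ j') :
    isMove S (basicMove i i' j j') ↔
      ind S i j + ind S i' j' = ind S i j' + ind S i' j := by
  have h3 : ∑ p ∈ S, basicMove i i' j j' p
      = ind S i j + ind S i' j' - ind S i j' - ind S i' j := by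
    rw [sum_ind]
    simp only [basicMove_eq hi hj, sum_bm_hit]
  constructor
  · intro h
    have := h.2.2
    omega
  · intro h
    refine ⟨fun p => ?_, fun q => ?_, by omega⟩
    · simp only [basicMove_eq hi hj, bm, ← Finset.mul_sum, Finset.sum_sub_distrib]
      simp
    · simp only [basicMove_eq hi hj, bm, ← Finset.sum_mul, Finset.sum_sub_distrib]
      simp

lemma conn_path (S : Finset (Fin R × Fin C)) {x y : Fin R → Fin C → ℕ} (h : Conn (ind S) x y) :
    ∃ (α : ℕ) (B : ℕ → (Fin R × Fin C → ℤ)), (∀ t < α, B t ∈ B0 S) ∧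
      (∀ p q, (y p q : ℤ) = (x p q : ℤ) + ∑ t ∈ Finset.range α, B t (p, q)) ∧
      (∀ a, a ≤ α → ∀ p q, 0 ≤ (x p q : ℤ) + ∑ t ∈ Finset.range a, B t (p, q)) := by
  induction h with
  | refl => exact ⟨0, fun _ => 0, by simp, by simp, fun a ha p q => by simp⟩
  | @tail y z _ h2 ih =>
    obtain ⟨α, B, hB, he, hn⟩ := ih
    obtain ⟨i, i', j, j', hb, hs⟩ := h2
    by_cases hd : i = i' ∨ j = j'
    · refine ⟨α, B, hB, fun p q => ?_, hn⟩
      rw [hs p q, ← he p q]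
      rcases hd with rfl | rfl <;> simp [bm]
    · push Not at hd
      have hsum : ∀ a ≤ α, ∀ p q, ∑ t ∈ Finset.range a,
          (if t < α then B t else basicMove i i' j j') (p, q)
          = ∑ t ∈ Finset.range a, B t (p, q) := by
        intro a ha p q
        refine Finset.sum_congr rfl fun t ht => ?_
        rw [if_pos (lt_of_lt_of_le (Finset.mem_range.1 ht) ha)]
      have hlast : ∀ p q, (z p q : ℤ) = (x p q : ℤ) + ∑ t ∈ Finset.range (α + 1),
          (if t < α then B t else basicMove i i' j j') (p, q) := by
        intro p q
        rw [Finset.sum_range_succ, hsum α le_rfl, if_neg (lt_irrefl _),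
          basicMove_eq hd.1 hd.2, hs p q, he p q]
        ring
      refine ⟨α + 1, fun t => if t < α then B t else basicMove i i' j j', ?_, hlast, ?_⟩
      · intro t ht
        dsimp only
        split_ifs with h1
        · exact hB t h1
        · exact ⟨i, i', j, j', hd.1, hd.2, rfl, (isMove_basic S hd.1 hd.2).2 hb⟩
      · intro a ha p q
        rcases Nat.lt_or_ge α a with h1 | h1
        · obtain rfl : a = α + 1 := by omega
          rw [← hlast p q]; positivity
        · rw [hsum a h1]; exact hn a h1 p q

lemma markov_of_connected (S : Finset (Fin R × Fin C))
    (hc : ∀ x y : Fin R → Fin C → ℕ, Fib (ind S) x y → Conn (ind S) x y) :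
    isMarkovBasis S (B0 S) := by
  refine ⟨?_, ?_, ?_, ?_⟩
  · refine (Set.finite_range (fun t : (Fin R × Fin R) × (Fin C × Fin C) =>
      basicMove t.1.1 t.1.2 t.2.1 t.2.2)).subset ?_
    rintro z ⟨i, i', j, j', -, -, rfl, -⟩
    exact ⟨((i, i'), (j, j')), rfl⟩
  · rintro z ⟨i, i', j, j', -, -, -, h⟩
    exact h
  · rintro z ⟨i, i', j, j', hi, hj, rfl, h⟩
    have e : -basicMove i i' j j' = basicMove i' i j j' := by
      funext p
      simp only [Pi.neg_apply, basicMove]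
      ring
    rw [isMove_basic S hi hj] at h
    refine ⟨i', i, j, j', hi.symm, hj, e, ?_⟩
    rw [e, isMove_basic S hi.symm hj]
    omega
  · intro x y hf hxy
    have hfib : Fib (ind S) (fun i j => x (i, j)) (fun i j => y (i, j)) := by
      refine ⟨fun i => by exact_mod_cast hf.1 i, fun j => by exact_mod_cast hf.2.1 j, ?_⟩
      rw [← sum_ind S (fun p => (x p : ℤ)), ← sum_ind S (fun p => (y p : ℤ))]
      exact_mod_cast hf.2.2
    obtain ⟨α, B, hB, he, hn⟩ := conn_path S (hc _ _ hfib)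
    refine ⟨α, B, ?_, hB, fun p => he p.1 p.2, fun a _ ha p => hn a ha p.1 p.2⟩
    rcases Nat.eq_zero_or_pos α with rfl | h
    · exfalso
      apply hxy
      funext p
      have := he p.1 p.2
      simp at this
      exact this.symm
    · exact h

lemma fiber_connected (S : Finset (Fin R × Fin C)) (h1 : ¬ patternP S) (h2 : ¬ patternPt S)
    (h3 : ¬ patternP Sᶜ) (h4 : ¬ patternPt Sᶜ) (x y : Fin R → Fin C → ℕ)
    (hf : Fib (ind S) x y) : Conn (ind S) x y := by
  have tot : ∑ i, ∑ j, (x i j : ℤ) = ((∑ i, ∑ j, x i j : ℕ) : ℤ) := by push_cast; rfl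
  refine connected ?_ _ x y hf tot
  by_cases hn : Nested (ind S)
  · intro x y hf hx
    exact common_nested (ind01 S) hn hf hx
  · unfold Nested at hn
    push Not at hn
    obtain ⟨i1, i2, j1, j2, hd⟩ := hn
    have D : ∀ i i' j j', (i, j) ∈ S → (i, j') ∉ S → (i', j) ∉ S → (i', j') ∈ S →
        (∀ q, (i, q) ∈ S ↔ (i', q) ∉ S) ∧ (∀ p, (p, j) ∈ S ↔ (p, j') ∉ S) := by
      intro i i' j j' a b c d
      have hi : i ≠ i' := by rintro rfl; exact c a
      have hj : j ≠ j' := by rintro rfl; exact b a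
      constructor
      · intro q
        by_cases e1 : q = j
        · subst e1; tauto
        by_cases e2 : q = j'
        · subst e2; tauto
        by_contra hcon
        by_cases e3 : (i, q) ∈ S
        · apply h3
          refine ⟨i, i', j', j, q, hi, hj.symm, Ne.symm e2, Ne.symm e1, ?_⟩
          simp only [mem_compl]
          tauto
        · apply h1
          refine ⟨i, i', j, j', q, hi, hj, Ne.symm e1, Ne.symm e2, ?_⟩
          tauto
      · intro p
        by_cases e1 : p = i
        · subst e1; tauto
        by_cases e2 : p = i'
        · subst e2; tauto
        by_contra hcon
        by_cases e3 : (p, j) ∈ S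
        · apply h4
          refine ⟨i', i, p, j, j', hi.symm, Ne.symm e2, Ne.symm e1, hj, ?_⟩
          simp only [mem_compl]
          tauto
        · apply h2
          refine ⟨i, i', p, j, j', hi, Ne.symm e1, Ne.symm e2, hj, ?_⟩
          tauto
    simp only [ind, ite_eq_left_iff, ite_eq_right_iff, zero_ne_one, one_ne_zero, imp_false,
      not_not] at hd
    obtain ⟨a, b, c, d⟩ := hd
    obtain ⟨Dc, Dr⟩ := D i1 i2 j1 j2 a b c d
    have key : ∀ p q, (p, q) ∈ S ↔ ((p, j1) ∈ S ↔ (i1, q) ∈ S) := by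
      intro p q
      have r1 := Dr p
      have r2 := Dc q
      by_cases e : (p, j1) ∈ S
      · have := (D p i2 j1 j2 e (r1.1 e) c d).1 q
        tauto
      · have := (D i1 p j1 j2 a b e (by tauto)).1 q
        tauto
    intro x y hf hx
    refine common_block (f := fun p => if (p, j1) ∈ S then 1 else -1)
      (g := fun q => if (i1, q) ∈ S then 1 else -1) (fun i => ?_) (fun i => ?_) ?_ hf hx
    · split_ifs <;> simp
    · split_ifs <;> simp
    · intro p q
      have := key p q
      unfold ind
      by_cases e1 : (p, j1) ∈ S <;> by_cases e2 : (i1, q) ∈ S <;>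
        simp only [e1, e2, iff_true, iff_false, not_true_eq_false, not_false_eq_true] at this <;>
        simp [e1, e2, this]

/-- an isolated table in a nontrivial fiber obstructs the Markov basis property -/
lemma not_markov (S : Finset (Fin R × Fin C)) (x y : Fin R × Fin C → ℕ)
    (hf : sameFiber S x y) (hxy : x ≠ y)
    (hx : ∀ i i' j j', i ≠ i' → j ≠ j' → 0 < x (i, j') → 0 < x (i', j) →
      ind S i j + ind S i' j' ≠ ind S i j' + ind S i' j) : ¬ isMarkovBasis S (B0 S) := by
  rintro ⟨-, -, -, h⟩
  obtain ⟨α, B, hα, hB, -, hn⟩ := h x y hf hxy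
  obtain ⟨i, i', j, j', hi, hj, he, hm⟩ := hB 0 hα
  have h1 := hn 1 le_rfl hα
  simp only [Finset.sum_range_one, he] at h1
  rw [he, isMove_basic S hi hj] at hm
  have k1 := h1 (i, j')
  have k2 := h1 (i', j)
  rw [basicMove_eq hi hj] at k1 k2
  simp [bm, hi, hj, hi.symm, hj.symm] at k1 k2
  exact hx i i' j j' hi hj (by omega) (by omega) hm

lemma fiber_of_cells (S : Finset (Fin R × Fin C)) (a b c d a' b' c' d' : Fin R × Fin C)
    (hrow : ∀ i, ((if a.1 = i then 1 else 0) + (if b.1 = i then 1 else 0)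
      + (if c.1 = i then 1 else 0) + (if d.1 = i then 1 else 0) : ℕ) =
      (if a'.1 = i then 1 else 0) + (if b'.1 = i then 1 else 0)
      + (if c'.1 = i then 1 else 0) + (if d'.1 = i then 1 else 0))
    (hcol : ∀ i, ((if a.2 = i then 1 else 0) + (if b.2 = i then 1 else 0)
      + (if c.2 = i then 1 else 0) + (if d.2 = i then 1 else 0) : ℕ) =
      (if a'.2 = i then 1 else 0) + (if b'.2 = i then 1 else 0)
      + (if c'.2 = i then 1 else 0) + (if d'.2 = i then 1 else 0))
    (hS : ((if a ∈ S then 1 else 0) + (if b ∈ S then 1 else 0)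
      + (if c ∈ S then 1 else 0) + (if d ∈ S then 1 else 0) : ℕ) =
      (if a' ∈ S then 1 else 0) + (if b' ∈ S then 1 else 0)
      + (if c' ∈ S then 1 else 0) + (if d' ∈ S then 1 else 0)) :
    sameFiber S (fun p => (if a = p then 1 else 0) + (if b = p then 1 else 0)
      + (if c = p then 1 else 0) + (if d = p then 1 else 0))
      (fun p => (if a' = p then 1 else 0) + (if b' = p then 1 else 0)
      + (if c' = p then 1 else 0) + (if d' = p then 1 else 0)) := by
  have r : ∀ (i : Fin R) (a : Fin R × Fin C),
      ∑ j, (if a = (i, j) then 1 else 0 : ℕ) = if a.1 = i then 1 else 0 := by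
    rintro i ⟨a1, a2⟩
    by_cases h : a1 = i <;> simp [h]
  have s : ∀ (j : Fin C) (a : Fin R × Fin C),
      ∑ i, (if a = (i, j) then 1 else 0 : ℕ) = if a.2 = j then 1 else 0 := by
    rintro j ⟨a1, a2⟩
    by_cases h : a2 = j <;> simp [h]
  have t : ∀ (a : Fin R × Fin C),
      ∑ p ∈ S, (if a = p then 1 else 0 : ℕ) = if a ∈ S then 1 else 0 := by
    intro a
    simp
  refine ⟨fun i => ?_, fun j => ?_, ?_⟩
  · simp only [Finset.sum_add_distrib, r]; exact hrow i
  · simp only [Finset.sum_add_distrib, s]; exact hcol j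
  · simp only [Finset.sum_add_distrib, t]; exact hS

lemma pos_cells {a b c d p : Fin R × Fin C}
    (h : 0 < (if a = p then 1 else 0) + (if b = p then 1 else 0)
      + (if c = p then 1 else 0) + (if d = p then 1 else 0)) :
    a = p ∨ b = p ∨ c = p ∨ d = p := by
  by_contra hcon
  push Not at hcon
  simp [hcon] at h

lemma not_markov_P (S T : Finset (Fin R × Fin C)) (hT : T = S ∨ T = Sᶜ) (hP : patternP T) :
    ¬ isMarkovBasis S (B0 S) := by
  obtain ⟨i1, i2, j1, j2, j3, hi, h12, h13, h23, a, b, c, d, e, f⟩ := hP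
  have hmem : ((i1, j1) ∈ S ∧ (i2, j2) ∈ S ∧ (i1, j2) ∉ S ∧ (i2, j1) ∉ S ∧ (i1, j3) ∉ S ∧
      (i2, j3) ∉ S) ∨ ((i1, j1) ∉ S ∧ (i2, j2) ∉ S ∧ (i1, j2) ∈ S ∧ (i2, j1) ∈ S ∧
      (i1, j3) ∈ S ∧ (i2, j3) ∈ S) := by
    rcases hT with rfl | rfl
    · left; tauto
    · right; simp only [mem_compl] at *; tauto
  refine not_markov S _ _ (fiber_of_cells S (i1, j1) (i1, j2) (i2, j3) (i2, j3)
    (i1, j3) (i1, j3) (i2, j1) (i2, j2) ?_ ?_ ?_) ?_ ?_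
  · intro i; first | rfl | (dsimp only; ring)
  · intro j; first | rfl | (dsimp only; ring)
  · rcases hmem with h | h <;> simp [h]
  · intro h
    have := congrFun h (i1, j1)
    simp [hi.symm, h13.symm] at this
  · intro i i' j j' n1 n2 p1 p2
    have q1 := pos_cells p1
    have q2 := pos_cells p2
    simp only [Prod.mk.injEq] at q1 q2
    unfold ind
    rcases q1 with ⟨rfl, rfl⟩ | ⟨rfl, rfl⟩ | ⟨rfl, rfl⟩ | ⟨rfl, rfl⟩ <;>
    rcases q2 with ⟨rfl, rfl⟩ | ⟨rfl, rfl⟩ | ⟨rfl, rfl⟩ | ⟨rfl, rfl⟩ <;>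
    first
    | exact absurd rfl n1
    | exact absurd rfl n2
    | (rcases hmem with h | h <;> simp [h])

lemma not_markov_Pt (S T : Finset (Fin R × Fin C)) (hT : T = S ∨ T = Sᶜ) (hP : patternPt T) :
    ¬ isMarkovBasis S (B0 S) := by
  obtain ⟨i1, i2, i3, j1, j2, h12, h13, h23, hj, a, b, c, d, e, f⟩ := hP
  have hmem : ((i1, j1) ∈ S ∧ (i2, j2) ∈ S ∧ (i1, j2) ∉ S ∧ (i2, j1) ∉ S ∧ (i3, j1) ∉ S ∧
      (i3, j2) ∉ S) ∨ ((i1, j1) ∉ S ∧ (i2, j2) ∉ S ∧ (i1, j2) ∈ S ∧ (i2, j1) ∈ S ∧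
      (i3, j1) ∈ S ∧ (i3, j2) ∈ S) := by
    rcases hT with rfl | rfl
    · left; tauto
    · right; simp only [mem_compl] at *; tauto
  refine not_markov S _ _ (fiber_of_cells S (i1, j1) (i2, j1) (i3, j2) (i3, j2)
    (i3, j1) (i3, j1) (i1, j2) (i2, j2) ?_ ?_ ?_) ?_ ?_
  · intro i; first | rfl | (dsimp only; ring)
  · intro j; first | rfl | (dsimp only; ring)
  · rcases hmem with h | h <;> simp [h]
  · intro h
    have := congrFun h (i1, j1)
    simp [hj.symm, h13.symm] at this
  · intro i i' j j' n1 n2 p1 p2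
    have q1 := pos_cells p1
    have q2 := pos_cells p2
    simp only [Prod.mk.injEq] at q1 q2
    unfold ind
    rcases q1 with ⟨rfl, rfl⟩ | ⟨rfl, rfl⟩ | ⟨rfl, rfl⟩ | ⟨rfl, rfl⟩ <;>
    rcases q2 with ⟨rfl, rfl⟩ | ⟨rfl, rfl⟩ | ⟨rfl, rfl⟩ | ⟨rfl, rfl⟩ <;>
    first
    | exact absurd rfl n1
    | exact absurd rfl n2
    | (rcases hmem with h | h <;> simp [h])

end Final

/-- Theorem 1 (main theorem): for a nonempty proper subtable `S`, `B₀(S)` is a Markov basis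
for `S` iff neither `S` nor `Sᶜ` exhibits pattern `P` or pattern `Pᵗ`. -/
theorem stmt0 {R C : ℕ} (hR : 1 ≤ R) (hC : 1 ≤ C)
    (S : Finset (Fin R × Fin C)) (hne : S.Nonempty) (hproper : S ≠ Finset.univ) :
    isMarkovBasis S (B0 S) ↔
      ¬(patternP S ∨ patternPt S ∨ patternP Sᶜ ∨ patternPt Sᶜ) := by
  constructor
  · rintro hM (h | h | h | h)
    · exact not_markov_P S S (Or.inl rfl) h hM
    · exact not_markov_Pt S S (Or.inl rfl) h hM
    · exact not_markov_P S Sᶜ (Or.inr rfl) h hM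
    · exact not_markov_Pt S Sᶜ (Or.inr rfl) h hM
  · intro h
    push Not at h
    obtain ⟨h1, h2, h3, h4⟩ := h
    exact markov_of_connected S (fiber_connected S h1 h2 h3 h4)
end

section
/- Let S be a nonempty proper subset of the set of cells I of an R×C table. If S or its complement Sᶜ exhibits pattern P or pattern Pᵗ, then B₀(S) is not a Markov basis for S. -/
open Finset

lemma aux_stuck {R C : ℕ} (S : Finset (Fin R × Fin C)) (x y : Fin R × Fin C → ℕ)
    (hf : sameFiber S x y) (hxy : x ≠ y)
    (h : ∀ i i' : Fin R, ∀ j j' : Fin C, i ≠ i' → j ≠ j' →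
      1 ≤ x (i, j') → 1 ≤ x (i', j) →
      ((if (i, j) ∈ S then 1 else 0) + (if (i', j') ∈ S then 1 else 0)
        - (if (i, j') ∈ S then 1 else 0) - (if (i', j) ∈ S then 1 else 0) : ℤ) ≠ 0) :
    ¬ isMarkovBasis S (B0 S) := by
  rintro ⟨-, -, -, hM⟩
  obtain ⟨α, B, hα, hB, -, hn⟩ := hM x y hf hxy
  obtain ⟨i, i', j, j', hi, hj, hz, -, -, hs⟩ := hB 0 hα
  have h1 := hn 1 le_rfl hα
  simp only [Finset.sum_range_one, hz] at h1
  rw [hz] at hs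
  have ha := h1 (i, j')
  have hb := h1 (i', j)
  simp [basicMove, hi, hj, hi.symm, hj.symm] at ha hb
  refine h i i' j j' hi hj (by omega) (by omega) ?_
  simpa [basicMove, Finset.sum_add_distrib, Finset.sum_sub_distrib, Finset.sum_ite_eq] using hs

lemma aux_row {R C : ℕ} (a b : Fin R × Fin C) (c : Fin R × Fin C) :
    let x : Fin R × Fin C → ℕ := fun p =>
      (if p = a then 1 else 0) + (if p = b then 1 else 0) + (if p = c then 2 else 0)
    (∀ i, ∑ j, x (i, j) = (if i = a.1 then 1 else 0) + (if i = b.1 then 1 else 0)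
      + (if i = c.1 then 2 else 0)) ∧
    (∀ j, ∑ i, x (i, j) = (if j = a.2 then 1 else 0) + (if j = b.2 then 1 else 0)
      + (if j = c.2 then 2 else 0)) ∧
    (∀ S : Finset (Fin R × Fin C), ∑ p ∈ S, x p = (if a ∈ S then 1 else 0)
      + (if b ∈ S then 1 else 0) + (if c ∈ S then 2 else 0)) := by
  obtain ⟨a1, a2⟩ := a
  obtain ⟨b1, b2⟩ := b
  obtain ⟨c1, c2⟩ := c
  refine ⟨fun i => ?_, fun j => ?_, fun S => ?_⟩
  · simp [Finset.sum_add_distrib, ite_and]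
  · simp [Finset.sum_add_distrib, ite_and]
  · simp [Finset.sum_add_distrib]

lemma aux_P {R C : ℕ} (S : Finset (Fin R × Fin C)) (h : patternP S ∨ patternP Sᶜ) :
    ¬ isMarkovBasis S (B0 S) := by
  have h' : ∃ i₁ i₂ : Fin R, ∃ j₁ j₂ j₃ : Fin C,
    i₁ ≠ i₂ ∧ j₁ ≠ j₂ ∧ j₁ ≠ j₃ ∧ j₂ ≠ j₃ ∧
    (((i₁, j₁) ∈ S ∧ (i₂, j₂) ∈ S ∧
    (i₁, j₂) ∉ S ∧ (i₂, j₁) ∉ S ∧ (i₁, j₃) ∉ S ∧ (i₂, j₃) ∉ S) ∨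
    ((i₁, j₁) ∉ S ∧ (i₂, j₂) ∉ S ∧
    (i₁, j₂) ∈ S ∧ (i₂, j₁) ∈ S ∧ (i₁, j₃) ∈ S ∧ (i₂, j₃) ∈ S)) := by
    rcases h with ⟨i₁, i₂, j₁, j₂, j₃, h1, h2, h3, h4, h5⟩ | ⟨i₁, i₂, j₁, j₂, j₃, h1, h2, h3, h4, h5⟩
    · exact ⟨i₁, i₂, j₁, j₂, j₃, h1, h2, h3, h4, Or.inl h5⟩
    · simp only [Finset.mem_compl, not_not] at h5
      exact ⟨i₁, i₂, j₁, j₂, j₃, h1, h2, h3, h4, Or.inr h5⟩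
  obtain ⟨i₁, i₂, j₁, j₂, j₃, h1, h2, h3, h4, h5⟩ := h'
  obtain ⟨r1, c1, s1⟩ := aux_row (i₁, j₁) (i₁, j₂) (i₂, j₃)
  obtain ⟨r2, c2, s2⟩ := aux_row (i₂, j₁) (i₂, j₂) (i₁, j₃)
  refine aux_stuck S _ _ ⟨fun i => (r1 i).trans (Eq.trans ?_ (r2 i).symm),
    fun j => (c1 j).trans (Eq.trans ?_ (c2 j).symm), (s1 S).trans (Eq.trans ?_ (s2 S).symm)⟩ ?_ ?_
  · dsimp only; split_ifs <;> first | rfl | (exfalso; simp_all)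
  · rfl
  · rcases h5 with h5 | h5 <;> simp [h5]
  · intro h
    have := congrFun h (i₁, j₁)
    simp [h1, h2, h3] at this
  · intro i i' j j' hi hj ha hb
    simp only [Prod.mk.injEq] at ha hb
    have ha' : (i = i₁ ∧ j' = j₁) ∨ (i = i₁ ∧ j' = j₂) ∨ (i = i₂ ∧ j' = j₃) := by
      by_contra hc
      simp only [not_or] at hc
      obtain ⟨c1, c2, c3⟩ := hc
      rw [if_neg c1, if_neg c2, if_neg c3] at ha
      omega
    have hb' : (i' = i₁ ∧ j = j₁) ∨ (i' = i₁ ∧ j = j₂) ∨ (i' = i₂ ∧ j = j₃) := by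
      by_contra hc
      simp only [not_or] at hc
      obtain ⟨c1, c2, c3⟩ := hc
      rw [if_neg c1, if_neg c2, if_neg c3] at hb
      omega
    clear ha hb r1 r2 c1 c2 s1 s2
    rcases ha' with ⟨rfl, rfl⟩ | ⟨rfl, rfl⟩ | ⟨rfl, rfl⟩ <;>
    rcases hb' with ⟨hb1, hb2⟩ | ⟨hb1, hb2⟩ | ⟨hb1, hb2⟩ <;>
    first
    | exact absurd hb1.symm hi
    | (subst hb1 hb2; rcases h5 with h5 | h5 <;> simp [h5])

lemma aux_Pt {R C : ℕ} (S : Finset (Fin R × Fin C)) (h : patternPt S ∨ patternPt Sᶜ) :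
    ¬ isMarkovBasis S (B0 S) := by
  have h' : ∃ i₁ i₂ i₃ : Fin R, ∃ j₁ j₂ : Fin C,
    i₁ ≠ i₂ ∧ i₁ ≠ i₃ ∧ i₂ ≠ i₃ ∧ j₁ ≠ j₂ ∧
    (((i₁, j₁) ∈ S ∧ (i₂, j₂) ∈ S ∧
    (i₂, j₁) ∉ S ∧ (i₁, j₂) ∉ S ∧ (i₃, j₁) ∉ S ∧ (i₃, j₂) ∉ S) ∨
    ((i₁, j₁) ∉ S ∧ (i₂, j₂) ∉ S ∧
    (i₂, j₁) ∈ S ∧ (i₁, j₂) ∈ S ∧ (i₃, j₁) ∈ S ∧ (i₃, j₂) ∈ S)) := by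
    rcases h with ⟨i₁, i₂, i₃, j₁, j₂, h1, h2, h3, h4, h5⟩ | ⟨i₁, i₂, i₃, j₁, j₂, h1, h2, h3, h4, h5⟩
    · exact ⟨i₁, i₂, i₃, j₁, j₂, h1, h2, h3, h4, Or.inl h5⟩
    · simp only [Finset.mem_compl, not_not] at h5
      exact ⟨i₁, i₂, i₃, j₁, j₂, h1, h2, h3, h4, Or.inr h5⟩
  obtain ⟨i₁, i₂, i₃, j₁, j₂, h1, h2, h3, h4, h5⟩ := h'
  obtain ⟨r1, c1, s1⟩ := aux_row (i₁, j₁) (i₂, j₁) (i₃, j₂)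
  obtain ⟨r2, c2, s2⟩ := aux_row (i₁, j₂) (i₂, j₂) (i₃, j₁)
  refine aux_stuck S _ _ ⟨fun i => (r1 i).trans (Eq.trans ?_ (r2 i).symm),
    fun j => (c1 j).trans (Eq.trans ?_ (c2 j).symm), (s1 S).trans (Eq.trans ?_ (s2 S).symm)⟩ ?_ ?_
  · rfl
  · dsimp only; split_ifs <;> first | rfl | (exfalso; simp_all)
  · rcases h5 with h5 | h5 <;> simp [h5]
  · intro h
    have := congrFun h (i₁, j₁)
    simp [h1, h2, h4] at this
  · intro i i' j j' hi hj ha hb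
    simp only [Prod.mk.injEq] at ha hb
    have ha' : (i = i₁ ∧ j' = j₁) ∨ (i = i₂ ∧ j' = j₁) ∨ (i = i₃ ∧ j' = j₂) := by
      by_contra hc
      simp only [not_or] at hc
      obtain ⟨c1, c2, c3⟩ := hc
      rw [if_neg c1, if_neg c2, if_neg c3] at ha
      omega
    have hb' : (i' = i₁ ∧ j = j₁) ∨ (i' = i₂ ∧ j = j₁) ∨ (i' = i₃ ∧ j = j₂) := by
      by_contra hc
      simp only [not_or] at hc
      obtain ⟨c1, c2, c3⟩ := hc
      rw [if_neg c1, if_neg c2, if_neg c3] at hb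
      omega
    clear ha hb r1 r2 c1 c2 s1 s2
    rcases ha' with ⟨rfl, rfl⟩ | ⟨rfl, rfl⟩ | ⟨rfl, rfl⟩ <;>
    rcases hb' with ⟨hb1, hb2⟩ | ⟨hb1, hb2⟩ | ⟨hb1, hb2⟩ <;>
    first
    | exact absurd hb2 hj
    | (subst hb1 hb2; rcases h5 with h5 | h5 <;> simp [h5])

/-- Proposition 1: if `S` or `Sᶜ` exhibits pattern `P` or `Pᵗ`, then `B₀(S)` is not a
Markov basis for `S`. -/
theorem stmt1 {R C : ℕ} (hR : 1 ≤ R) (hC : 1 ≤ C)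
    (S : Finset (Fin R × Fin C)) (hne : S.Nonempty) (hproper : S ≠ Finset.univ)
    (hpat : patternP S ∨ patternPt S ∨ patternP Sᶜ ∨ patternPt Sᶜ) :
    ¬ isMarkovBasis S (B0 S) := by
  rcases hpat with h | h | h | h
  · exact aux_P S (Or.inl h)
  · exact aux_Pt S (Or.inl h)
  · exact aux_P S (Or.inr h)
  · exact aux_Pt S (Or.inr h)
end

section
/- Let R = 2, C = 3 and S = {(1,1),(2,2)}. The set of tables x : {1,2}×{1,2,3} → ℕ with row sums x_{11}+x_{12}+x_{13} = 2 and x_{21}+x_{22}+x_{23} = 2, column sums x_{11}+x_{21} = 1, x_{12}+x_{22} = 1, x_{13}+x_{23} = 2, and S-sum x_{11}+x_{22} = 1 has exactly two elements, namely (x_{11},x_{12},x_{13};x_{21},x_{22},x_{23}) = (1,1,0;0,0,2) and (0,0,2;1,1,0). Consequently, their difference, the move with rows (1,1,−2) and (−1,−1,2), or its negative, belongs to every Markov basis for S. -/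
open Finset

/-- The subtable `S = {(1,1),(2,2)}` of a 2×3 table (0-indexed: `{(0,0),(1,1)}`). -/
def egS : Finset (Fin 2 × Fin 3) := {((0 : Fin 2), (0 : Fin 3)), ((1 : Fin 2), (1 : Fin 3))}

/-- The table with rows `(1,1,0)` and `(0,0,2)`. -/
def egX : Fin 2 × Fin 3 → ℕ := fun p => ![![1, 1, 0], ![0, 0, 2]] p.1 p.2

/-- The table with rows `(0,0,2)` and `(1,1,0)`. -/
def egY : Fin 2 × Fin 3 → ℕ := fun p => ![![0, 0, 2], ![1, 1, 0]] p.1 p.2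

/-- The move `egX − egY`, with rows `(1,1,−2)` and `(−1,−1,2)`. -/
def egZ : Fin 2 × Fin 3 → ℤ := fun p => ![![1, 1, -2], ![-1, -1, 2]] p.1 p.2

/-- Every move for `egS` is an integer multiple of `egZ`. -/
lemma egS_move_form (z : Fin 2 × Fin 3 → ℤ) (h : isMove egS z) :
    ∀ p, z p = z (0, 0) * egZ p := by
  obtain ⟨h1, h2, h3⟩ := h
  have r0 := h1 0
  have r1 := h1 1
  have c0 := h2 0
  have c1 := h2 1
  have c2 := h2 2
  have hs : z (0, 0) + z (1, 1) = 0 := by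
    rw [egS, Finset.sum_pair (by decide)] at h3
    exact h3
  simp only [Fin.sum_univ_three, Fin.sum_univ_two] at r0 r1 c0 c1 c2
  rintro ⟨i, j⟩
  fin_cases i <;> fin_cases j <;> simp [egZ] <;> linarith

/-- The fiber of the 2×3 example has exactly the two elements `egX` and `egY`; consequently
their difference `egZ` (or its negative) belongs to every Markov basis for `S`. -/
theorem stmt2 :
    (∀ x : Fin 2 × Fin 3 → ℕ,
      (x (0, 0) + x (0, 1) + x (0, 2) = 2 ∧ x (1, 0) + x (1, 1) + x (1, 2) = 2 ∧
       x (0, 0) + x (1, 0) = 1 ∧ x (0, 1) + x (1, 1) = 1 ∧ x (0, 2) + x (1, 2) = 2 ∧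
       x (0, 0) + x (1, 1) = 1) ↔ (x = egX ∨ x = egY)) ∧
    (∀ ℬ : Set (Fin 2 × Fin 3 → ℤ), isMarkovBasis egS ℬ → (egZ ∈ ℬ ∨ -egZ ∈ ℬ)) := by
  constructor
  · intro x
    constructor
    · rintro ⟨h1, h2, h3, h4, h5, h6⟩
      have h : x (0, 0) = 1 ∨ x (0, 0) = 0 := by omega
      rcases h with h | h
      · left
        ext ⟨i, j⟩
        fin_cases i <;> fin_cases j <;> simp [egX] <;> omega
      · right
        ext ⟨i, j⟩
        fin_cases i <;> fin_cases j <;> simp [egY] <;> omega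
    · rintro (rfl | rfl) <;> decide
  · rintro ℬ ⟨-, hmove, -, hconn⟩
    by_contra hcon
    push Not at hcon
    obtain ⟨hz, hnz⟩ := hcon
    have hne : egX ≠ egY := fun h => by
      have := congrFun h (0, 0)
      revert this
      decide
    have hfib : sameFiber egS egX egY := by
      refine ⟨by decide, by decide, by decide⟩
    obtain ⟨α, B, -, hB, hend, hpos⟩ := hconn egX egY hfib hne
    -- the coefficient of each partial sum stays zero
    have key : ∀ a, a ≤ α → ∑ t ∈ Finset.range a, B t (0, 0) = 0 := by
      intro a
      induction a with
      | zero => intro _; simp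
      | succ a ih =>
        intro ha
        have h0 := ih (by omega)
        have hm := egS_move_form _ (hmove _ (hB a (by omega)))
        have hall : ∀ t ∈ Finset.range (a + 1), B t (1, 0) = - B t (0, 0) := by
          intro t ht
          have := egS_move_form _ (hmove _ (hB t (by
            have := Finset.mem_range.mp ht
            omega))) (1, 0)
          simpa [egZ] using this
        have p0 := hpos (a + 1) (by omega) ha (0, 0)
        have p1 := hpos (a + 1) (by omega) ha (1, 0)
        rw [Finset.sum_congr rfl hall, Finset.sum_neg_distrib] at p1
        rw [Finset.sum_range_succ, h0] at p0 p1 ⊢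
        simp [egX] at p0 p1
        have h1 : B a (0, 0) ≠ -1 := by
          intro h
          apply hnz
          have : B a = -egZ := by
            ext p
            rw [hm p, h]
            simp
          rw [← this]
          exact hB a (by omega)
        omega
    have := hend (0, 0)
    rw [key α le_rfl] at this
    simp [egX, egY] at this
end

section
/- Let S ⊆ I and let X, Y be tables in the same S-fiber. Suppose i ≠ i', j ≠ j', the basic move B = B(i,i';j,j') belongs to B₀(S), and x_{i'j} < y_{i'j} and x_{ij'} < y_{ij'}. Then Y + B is a nonnegative table lying in the same S-fiber as X and Y, and ‖X − Y − B‖₁ ≤ ‖X − Y‖₁; if moreover x_{ij} > y_{ij} or x_{i'j'} > y_{i'j'}, then ‖X − Y − B‖₁ < ‖X − Y‖₁. (Here ‖z‖₁ = Σ_{(i,j)∈I} |z_{ij}|.) -/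
open Finset

/-- If `X, Y` are in the same `S`-fiber, `B = B(i,i';j,j') ∈ B₀(S)`, and
`x_{i'j} < y_{i'j}`, `x_{ij'} < y_{ij'}`, then `Y + B` is a nonnegative table in the same
`S`-fiber, the 1-norm of `X − Y − B` is at most that of `X − Y`, with strict inequality if
moreover `x_{ij} > y_{ij}` or `x_{i'j'} > y_{i'j'}`. -/
theorem stmt6 {R C : ℕ} (S : Finset (Fin R × Fin C)) (x y : Fin R × Fin C → ℕ)
    (hf : sameFiber S x y) (i i' : Fin R) (j j' : Fin C) (hi : i ≠ i') (hj : j ≠ j')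
    (hB : basicMove i i' j j' ∈ B0 S)
    (h1 : x (i', j) < y (i', j)) (h2 : x (i, j') < y (i, j')) :
    (∀ p, 0 ≤ (y p : ℤ) + basicMove i i' j j' p) ∧
    (∀ r : Fin R, ∑ c : Fin C, ((y (r, c) : ℤ) + basicMove i i' j j' (r, c))
        = ∑ c : Fin C, (x (r, c) : ℤ)) ∧
    (∀ c : Fin C, ∑ r : Fin R, ((y (r, c) : ℤ) + basicMove i i' j j' (r, c))
        = ∑ r : Fin R, (x (r, c) : ℤ)) ∧
    (∑ p ∈ S, ((y p : ℤ) + basicMove i i' j j' p) = ∑ p ∈ S, (x p : ℤ)) ∧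
    (∑ p : Fin R × Fin C, |(x p : ℤ) - (y p : ℤ) - basicMove i i' j j' p|
        ≤ ∑ p : Fin R × Fin C, |(x p : ℤ) - (y p : ℤ)|) ∧
    ((y (i, j) < x (i, j) ∨ y (i', j') < x (i', j')) →
      ∑ p : Fin R × Fin C, |(x p : ℤ) - (y p : ℤ) - basicMove i i' j j' p|
        < ∑ p : Fin R × Fin C, |(x p : ℤ) - (y p : ℤ)|) := by
  obtain ⟨-, -, -, -, -, -, -, hr, hc, hS⟩ := hB
  obtain ⟨fr, fc, fS⟩ := hf
  have e1 : basicMove i i' j j' (i, j) = 1 := by simp [basicMove, hi, hj]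
  have e2 : basicMove i i' j j' (i', j') = 1 := by simp [basicMove, hi.symm, hj.symm]
  have e3 : basicMove i i' j j' (i, j') = -1 := by simp [basicMove, hi, hj.symm]
  have e4 : basicMove i i' j j' (i', j) = -1 := by simp [basicMove, hi.symm, hj]
  have e5 : ∀ p, p ≠ (i, j) → p ≠ (i', j') → p ≠ (i, j') → p ≠ (i', j) →
      basicMove i i' j j' p = 0 := by
    intro p a b c d
    simp [basicMove, a, b, c, d]
  have hsum : ∑ p : Fin R × Fin C, basicMove i i' j j' p = 0 := by
    rw [Fintype.sum_prod_type]
    exact Finset.sum_eq_zero fun r _ => hr r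
  generalize basicMove i i' j j' = B at *
  have key : ∀ p, 0 ≤ (y p : ℤ) + B p ∧
      |(x p : ℤ) - (y p : ℤ) - B p| ≤ |(x p : ℤ) - (y p : ℤ)| + B p := by
    intro p
    by_cases a : p = (i, j)
    · subst a; rw [e1]; grind
    by_cases b : p = (i', j')
    · subst b; rw [e2]; grind
    by_cases c : p = (i, j')
    · subst c; rw [e3]; grind
    by_cases d : p = (i', j)
    · subst d; rw [e4]; grind
    rw [e5 p a b c d]; simp
  have hadd : ∑ p : Fin R × Fin C, (|(x p : ℤ) - (y p : ℤ)| + B p)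
      = ∑ p : Fin R × Fin C, |(x p : ℤ) - (y p : ℤ)| := by
    rw [Finset.sum_add_distrib, hsum, add_zero]
  refine ⟨fun p => (key p).1, ?_, ?_, ?_, ?_, ?_⟩
  · intro r
    rw [Finset.sum_add_distrib, hr, add_zero]
    exact_mod_cast (fr r).symm
  · intro c
    rw [Finset.sum_add_distrib, hc, add_zero]
    exact_mod_cast (fc c).symm
  · rw [Finset.sum_add_distrib, hS, add_zero]
    exact_mod_cast fS.symm
  · rw [← hadd]
    exact Finset.sum_le_sum fun p _ => (key p).2
  · intro h
    rw [← hadd]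
    refine Finset.sum_lt_sum (fun p _ => (key p).2) ?_
    rcases h with h | h
    · refine ⟨(i, j), Finset.mem_univ _, ?_⟩
      rw [e1]; grind
    · refine ⟨(i', j'), Finset.mem_univ _, ?_⟩
      rw [e2]; grind
end

section
/- Let S ⊆ I be equivalent to a 2×2 block diagonal set or to a triangular set, and let X ≠ Y be tables in the same S-fiber with Z = X − Y. If there exist cells (i,j) and (i',j') lying in the same block of S with z_{ij} > 0 and z_{i'j'} < 0, then ‖X − Y‖₁ can be reduced by B₀(S). -/
open Finset

lemma ind_sum {R C : ℕ} (c : Fin R × Fin C) :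
    ∑ p : Fin R × Fin C, (if p = c then (1 : ℤ) else 0) = 1 := by simp

lemma basicMove_mem {R C : ℕ} (S : Finset (Fin R × Fin C)) (a b : Fin R) (c d : Fin C)
    (hab : a ≠ b) (hcd : c ≠ d)
    (h : (∀ j, (a, j) ∈ S ↔ (b, j) ∈ S) ∨ (∀ i, (i, c) ∈ S ↔ (i, d) ∈ S)) :
    basicMove a b c d ∈ B0 S := by
  refine ⟨a, b, c, d, hab, hcd, rfl, ?_, ?_, ?_⟩
  · intro i
    simp only [basicMove, Prod.mk.injEq, Finset.sum_add_distrib, Finset.sum_sub_distrib, ite_and]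
    by_cases h1 : i = a <;> by_cases h2 : i = b <;> simp [h1, h2]
  · intro j
    simp only [basicMove, Prod.mk.injEq, Finset.sum_add_distrib, Finset.sum_sub_distrib,
      ite_and]
    by_cases h1 : j = c <;> by_cases h2 : j = d <;> simp [h1, h2]
  · simp only [basicMove, Finset.sum_add_distrib, Finset.sum_sub_distrib, Finset.sum_ite_eq']
    rcases h with h | h
    · have h1 := h c
      have h2 := h d
      split_ifs <;> simp_all
    · have h1 := h a
      have h2 := h b
      split_ifs <;> simp_all

lemma oneStep {R C : ℕ} (S : Finset (Fin R × Fin C)) (x y : Fin R × Fin C → ℕ)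
    (a b : Fin R) (c d : Fin C) (hab : a ≠ b) (hcd : c ≠ d)
    (h : (∀ j, (a, j) ∈ S ↔ (b, j) ∈ S) ∨ (∀ i, (i, c) ∈ S ↔ (i, d) ∈ S))
    (h1 : x (a, c) < y (a, c)) (h2 : x (b, d) < y (b, d)) (h3 : y (a, d) < x (a, d)) :
    normReducible S x y := by
  refine ⟨0, 1, fun _ => 0, fun _ => basicMove a b c d, by norm_num, by simp,
    fun _ _ => basicMove_mem S a b c d hab hcd h, by intros; omega, ?_, ?_⟩
  · intro t ht1 ht2 p
    obtain rfl : t = 1 := by omega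
    simp only [Finset.sum_range_one, basicMove]
    grind
  · simp only [Finset.sum_range_zero, Finset.sum_range_one, add_zero]
    have key : ∀ p : Fin R × Fin C, |(x p : ℤ) - y p + basicMove a b c d p| ≤
        |(x p : ℤ) - y p| - (if p = (a, c) then 1 else 0) - (if p = (b, d) then 1 else 0)
          - (if p = (a, d) then 1 else 0) + (if p = (b, c) then 1 else 0) := by
      intro p
      simp only [basicMove]
      grind
    have := Finset.sum_le_sum (fun p (_ : p ∈ Finset.univ) => key p)
    simp only [Finset.sum_add_distrib, Finset.sum_sub_distrib, ind_sum] at this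
    omega

lemma twoStep {R C : ℕ} (S : Finset (Fin R × Fin C)) (x y : Fin R × Fin C → ℕ)
    (i i' i2 : Fin R) (j j' j3 : Fin C) (h1 : i ≠ i') (h2 : i2 ≠ i) (h3 : i2 ≠ i')
    (h4 : j ≠ j') (h5 : j3 ≠ j) (h6 : j3 ≠ j')
    (hr : ∀ l, (i, l) ∈ S ↔ (i', l) ∈ S) (hc : ∀ k, (k, j) ∈ S ↔ (k, j') ∈ S)
    (z1 : y (i, j) < x (i, j)) (z2 : x (i', j') < y (i', j'))
    (z3 : y (i', j3) < x (i', j3)) (z4 : x (i2, j) < y (i2, j)) :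
    normReducible S x y := by
  refine ⟨1, 1, fun _ => basicMove i i' j3 j, fun _ => basicMove i' i2 j' j, by norm_num,
    fun _ _ => basicMove_mem S _ _ _ _ h1 h5 (Or.inl hr),
    fun _ _ => basicMove_mem S _ _ _ _ h3.symm h4.symm (Or.inr fun k => (hc k).symm), ?_, ?_, ?_⟩
  · intro t ht1 ht2 p
    obtain rfl : t = 1 := by omega
    simp only [Finset.sum_range_one, basicMove]
    grind
  · intro t ht1 ht2 p
    obtain rfl : t = 1 := by omega
    simp only [Finset.sum_range_one, basicMove]
    grind
  · simp only [Finset.sum_range_one]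
    have key : ∀ p : Fin R × Fin C,
        |(x p : ℤ) - y p + basicMove i i' j3 j p + basicMove i' i2 j' j p| ≤
        |(x p : ℤ) - y p| - (if p = (i, j) then 1 else 0) - (if p = (i', j3) then 1 else 0)
          + (if p = (i, j3) then 1 else 0) - (if p = (i', j') then 1 else 0)
          - (if p = (i2, j) then 1 else 0) + (if p = (i2, j') then 1 else 0) := by
      intro p
      clear hr hc
      simp only [basicMove]
      grind (splits := 30)
    have := Finset.sum_le_sum (fun p (_ : p ∈ Finset.univ) => key p)
    simp only [Finset.sum_add_distrib, Finset.sum_sub_distrib, ind_sum] at this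
    omega

lemma exists_lt_of_sum_eq {n : ℕ} (f g : Fin n → ℕ) (h : ∑ k, f k = ∑ k, g k) (k : Fin n)
    (hk : g k < f k) : ∃ l, f l < g l := by
  by_contra! hc
  have := Finset.sum_lt_sum (s := Finset.univ) (fun l _ => hc l) ⟨k, Finset.mem_univ _, hk⟩
  omega

/-- Lemma 2: if `S` is equivalent to a 2×2 block diagonal set or to a triangular set, and
`Z = X − Y` has a positive cell and a negative cell in the same block of `S`, then
`‖X − Y‖₁` can be reduced by `B₀(S)`. -/
theorem stmt7 {R C : ℕ} (S : Finset (Fin R × Fin C))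
    (hS : isBlockDiag S ∨ isTriangular S)
    (x y : Fin R × Fin C → ℕ) (hf : sameFiber S x y) (hxy : x ≠ y)
    (p q : Fin R × Fin C) (hpq : sameBlock S p q)
    (hp : 0 < (x p : ℤ) - (y p : ℤ)) (hq : (x q : ℤ) - (y q : ℤ) < 0) :
    normReducible S x y := by
  obtain ⟨i, j⟩ := p
  obtain ⟨i', j'⟩ := q
  obtain ⟨hr, hc⟩ := hpq
  obtain ⟨hfr, hfc, -⟩ := hf
  simp only at hr hc
  have z1 : y (i, j) < x (i, j) := by omega
  have z2 : x (i', j') < y (i', j') := by omega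
  -- the case of two cells in one row
  have rowCase : ∀ k, y (k, j) < x (k, j) → x (k, j') < y (k, j') → normReducible S x y := by
    intro k u1 u2
    obtain ⟨i2, u3⟩ := exists_lt_of_sum_eq (fun l => x (l, j)) (fun l => y (l, j)) (hfc j) k u1
    refine oneStep S x y k i2 j' j ?_ ?_ (Or.inr fun l => (hc l).symm) u2 u3 u1
    · rintro rfl; omega
    · rintro rfl; omega
  -- the case of two cells in one column
  have colCase : ∀ l, y (i, l) < x (i, l) → x (i', l) < y (i', l) → normReducible S x y := by
    intro l u1 u2
    obtain ⟨j2, u3⟩ := exists_lt_of_sum_eq (fun k => x (i, k)) (fun k => y (i, k)) (hfr i) l u1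
    refine oneStep S x y i i' j2 l ?_ ?_ (Or.inl hr) u3 u2 u1
    · rintro rfl; omega
    · rintro rfl; omega
  rcases lt_trichotomy (x (i', j)) (y (i', j)) with h | h | h
  · exact colCase j z1 h
  · obtain ⟨i2, u⟩ := exists_lt_of_sum_eq (fun l => x (l, j)) (fun l => y (l, j)) (hfc j) i z1
    obtain ⟨j3, v⟩ := exists_lt_of_sum_eq (fun k => y (i', k)) (fun k => x (i', k))
      (hfr i').symm j' z2
    refine twoStep S x y i i' i2 j j' j3 ?_ ?_ ?_ ?_ ?_ ?_ hr hc z1 z2 v u <;>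
      (rintro rfl; omega)
  · exact rowCase i' h z2
end

section
/- If S ⊆ I is equivalent to a 2×2 block diagonal set, then B₀(S) is a Markov basis for S. -/
open Finset

namespace BlockDiagAux

variable {R C : ℕ}

lemma basicMove_isMove (R₁ : Finset (Fin R)) (C₁ : Finset (Fin C))
    {i i' : Fin R} {j j' : Fin C}
    (h : (i ∈ R₁ ↔ i' ∈ R₁) ∨ (j ∈ C₁ ↔ j' ∈ C₁)) :
    isMove (R₁ ×ˢ C₁ ∪ R₁ᶜ ×ˢ C₁ᶜ) (basicMove i i' j j') := by
  refine ⟨fun a => ?_, fun b => ?_, ?_⟩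
  · simp only [basicMove, Finset.sum_sub_distrib, Finset.sum_add_distrib, Prod.mk.injEq, ite_and]
    by_cases h1 : a = i <;> by_cases h2 : a = i' <;> simp [h1, h2]
  · simp only [basicMove, Finset.sum_sub_distrib, Finset.sum_add_distrib, Prod.mk.injEq,
      and_comm, ite_and]
    by_cases h1 : b = j <;> by_cases h2 : b = j' <;> simp [h1, h2]
  · simp only [basicMove, Finset.sum_sub_distrib, Finset.sum_add_distrib, Finset.sum_ite_eq',
      Finset.mem_union, Finset.mem_product, Finset.mem_compl]
    by_cases h1 : i ∈ R₁ <;> by_cases h2 : i' ∈ R₁ <;> by_cases h3 : j ∈ C₁ <;>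
      by_cases h4 : j' ∈ C₁ <;> simp_all

/-- One step: adding a basic move of `B₀(S)` while staying nonnegative. -/
def Step (S : Finset (Fin R × Fin C)) (X X' : Fin R × Fin C → ℤ) : Prop :=
  ∃ B ∈ B0 S, X' = X + B ∧ ∀ p, 0 ≤ X' p

/-- The `ℓ¹` distance. -/
def dist1 (X Y : Fin R × Fin C → ℤ) : ℤ := ∑ p, |X p - Y p|

lemma dist1_basic (X Y : Fin R × Fin C → ℤ) {i i' : Fin R} {j j' : Fin C}
    (hi : i ≠ i') (hj : j ≠ j') :
    dist1 (X + basicMove i i' j j') Y = dist1 X Y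
      + (|X (i, j) - Y (i, j) + 1| - |X (i, j) - Y (i, j)|)
      + (|X (i', j') - Y (i', j') + 1| - |X (i', j') - Y (i', j')|)
      + (|X (i, j') - Y (i, j') - 1| - |X (i, j') - Y (i, j')|)
      + (|X (i', j) - Y (i', j) - 1| - |X (i', j) - Y (i', j)|) := by
  have key : ∀ p, |(X + basicMove i i' j j') p - Y p| = |X p - Y p|
      + (if p = (i, j) then (|X (i, j) - Y (i, j) + 1| - |X (i, j) - Y (i, j)|) else 0)
      + (if p = (i', j') then (|X (i', j') - Y (i', j') + 1| - |X (i', j') - Y (i', j')|) else 0)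
      + (if p = (i, j') then (|X (i, j') - Y (i, j') - 1| - |X (i, j') - Y (i, j')|) else 0)
      + (if p = (i', j) then (|X (i', j) - Y (i', j) - 1| - |X (i', j) - Y (i', j)|) else 0) := by
    intro p
    by_cases h1 : p = (i, j)
    · subst h1
      simp [basicMove, hi, hj]
      congr 1; ring
    by_cases h2 : p = (i', j')
    · subst h2
      simp [basicMove, hi.symm, hj.symm]
      congr 1; ring
    by_cases h3 : p = (i, j')
    · subst h3
      simp [basicMove, hi, hj.symm]
      congr 1; ring
    by_cases h4 : p = (i', j)
    · subst h4
      simp [basicMove, hi.symm, hj]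
      congr 1; ring
    simp [basicMove, h1, h2, h3, h4]
  unfold dist1
  rw [Finset.sum_congr rfl (fun p _ => key p)]
  simp [Finset.sum_add_distrib]

lemma step_basic (R₁ : Finset (Fin R)) (C₁ : Finset (Fin C)) (X : Fin R × Fin C → ℤ)
    (hX : ∀ p, 0 ≤ X p) {i i' : Fin R} {j j' : Fin C} (hi : i ≠ i') (hj : j ≠ j')
    (h : (i ∈ R₁ ↔ i' ∈ R₁) ∨ (j ∈ C₁ ↔ j' ∈ C₁))
    (h1 : 0 < X (i, j')) (h2 : 0 < X (i', j)) :
    Step (R₁ ×ˢ C₁ ∪ R₁ᶜ ×ˢ C₁ᶜ) X (X + basicMove i i' j j') := by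
  refine ⟨_, ⟨i, i', j, j', hi, hj, rfl, basicMove_isMove R₁ C₁ h⟩, rfl, fun p => ?_⟩
  have hp := hX p
  by_cases h3 : p = (i, j')
  · subst h3
    simp [basicMove, hi, hj.symm]; omega
  by_cases h4 : p = (i', j)
  · subst h4
    simp [basicMove, hi.symm, hj]; omega
  simp only [Pi.add_apply, basicMove, h3, h4, if_false]
  split_ifs <;> omega

lemma exists_neg_of_sum {ι : Type*} {s : Finset ι} {f : ι → ℤ} (h : ∑ a ∈ s, f a = 0) {a : ι}
    (ha : a ∈ s) (hf : 0 < f a) : ∃ b ∈ s, f b < 0 := by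
  by_contra! hc
  have := Finset.sum_pos' hc ⟨a, ha, hf⟩
  omega

lemma exists_pos_of_sum {ι : Type*} {s : Finset ι} {f : ι → ℤ} (h : ∑ a ∈ s, f a = 0) {a : ι}
    (ha : a ∈ s) (hf : f a < 0) : ∃ b ∈ s, 0 < f b := by
  have h' : ∑ a ∈ s, (fun x => - f x) a = 0 := by simp [h]
  obtain ⟨b, hb, hlt⟩ := exists_neg_of_sum h' ha (by simpa using hf)
  exact ⟨b, hb, by simpa using hlt⟩

lemma isMove_add {S : Finset (Fin R × Fin C)} {z w : Fin R × Fin C → ℤ} (hz : isMove S z)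
    (hw : isMove S w) : isMove S (z + w) := by
  obtain ⟨a, b, c⟩ := hz
  obtain ⟨a', b', c'⟩ := hw
  refine ⟨fun i => ?_, fun j => ?_, ?_⟩ <;> simp [Finset.sum_add_distrib, *]

lemma isMove_of_step {S : Finset (Fin R × Fin C)} {X X' Y : Fin R × Fin C → ℤ}
    (h : Step S X X') (hz : isMove S (X - Y)) : isMove S (X' - Y) := by
  obtain ⟨B, ⟨_, _, _, _, _, _, _, hB⟩, rfl, _⟩ := h
  have := isMove_add hz hB
  rwa [show X + B - Y = X - Y + B by ring]

lemma caseA (R₁ : Finset (Fin R)) (C₁ : Finset (Fin C)) (X Y : Fin R × Fin C → ℤ)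
    (hX : ∀ p, 0 ≤ X p) (hY : ∀ p, 0 ≤ Y p)
    (hz : isMove (R₁ ×ˢ C₁ ∪ R₁ᶜ ×ˢ C₁ᶜ) (X - Y)) {i : Fin R} {j j' : Fin C}
    (hj : j ∈ C₁ ↔ j' ∈ C₁) (h1 : 0 < X (i, j) - Y (i, j)) (h2 : X (i, j') - Y (i, j') < 0) :
    ∃ X', Step (R₁ ×ˢ C₁ ∪ R₁ᶜ ×ˢ C₁ᶜ) X X' ∧ dist1 X' Y < dist1 X Y := by
  obtain ⟨i', -, h3⟩ := exists_pos_of_sum (hz.2.1 j') (Finset.mem_univ i) (by simpa using h2)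
  simp only [Pi.sub_apply] at h3
  have hi : i ≠ i' := by rintro rfl; omega
  have hjj : j' ≠ j := by rintro rfl; omega
  have y1 := hY (i, j)
  have y2 := hY (i', j')
  refine ⟨X + basicMove i i' j' j,
    step_basic R₁ C₁ X hX hi hjj (Or.inr hj.symm) (by omega) (by omega), ?_⟩
  rw [dist1_basic X Y hi hjj]
  simp only [abs_eq_max_neg]
  omega

lemma block_sum (R₁ : Finset (Fin R)) (C₁ : Finset (Fin C)) (z : Fin R × Fin C → ℤ)
    (hz : isMove (R₁ ×ˢ C₁ ∪ R₁ᶜ ×ˢ C₁ᶜ) z) (i : Fin R) (j : Fin C) :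
    ∃ T : Finset (Fin R × Fin C), (∀ p, p ∈ T ↔ ((p.1 ∈ R₁ ↔ i ∈ R₁) ∧ (p.2 ∈ C₁ ↔ j ∈ C₁))) ∧
      ∑ p ∈ T, z p = 0 := by
  obtain ⟨hr, hc, hs⟩ := hz
  have hd : Disjoint (R₁ ×ˢ C₁) (R₁ᶜ ×ˢ C₁ᶜ) := by
    rw [Finset.disjoint_left]
    intro p; simp only [Finset.mem_product, Finset.mem_compl]; tauto
  rw [Finset.sum_union hd] at hs
  have row : ∀ A : Finset (Fin R), ∑ p ∈ A ×ˢ C₁, z p + ∑ p ∈ A ×ˢ C₁ᶜ, z p = 0 := by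
    intro A
    rw [Finset.sum_product, Finset.sum_product, ← Finset.sum_add_distrib]
    refine Finset.sum_eq_zero fun a _ => ?_
    rw [Finset.sum_add_sum_compl, hr]
  have col : ∀ A : Finset (Fin C), ∑ p ∈ R₁ ×ˢ A, z p + ∑ p ∈ R₁ᶜ ×ˢ A, z p = 0 := by
    intro A
    rw [Finset.sum_product_right, Finset.sum_product_right, ← Finset.sum_add_distrib]
    refine Finset.sum_eq_zero fun a _ => ?_
    rw [Finset.sum_add_sum_compl R₁ (fun x => z (x, a)), hc]
  have r1 := row R₁
  have r2 := row R₁ᶜ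
  have c1 := col C₁
  by_cases hi : i ∈ R₁ <;> by_cases hj : j ∈ C₁
  · exact ⟨R₁ ×ˢ C₁, by simp [hi, hj], by omega⟩
  · exact ⟨R₁ ×ˢ C₁ᶜ, by simp [hi, hj], by omega⟩
  · exact ⟨R₁ᶜ ×ˢ C₁, by simp [hi, hj], by omega⟩
  · exact ⟨R₁ᶜ ×ˢ C₁ᶜ, by simp [hi, hj], by omega⟩

lemma reduce (R₁ : Finset (Fin R)) (C₁ : Finset (Fin C)) (X Y : Fin R × Fin C → ℤ)
    (hX : ∀ p, 0 ≤ X p) (hY : ∀ p, 0 ≤ Y p)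
    (hz : isMove (R₁ ×ˢ C₁ ∪ R₁ᶜ ×ˢ C₁ᶜ) (X - Y)) (hne : X ≠ Y) :
    ∃ X', Relation.ReflTransGen (Step (R₁ ×ˢ C₁ ∪ R₁ᶜ ×ˢ C₁ᶜ)) X X' ∧
      dist1 X' Y < dist1 X Y := by
  by_cases hA : ∃ (i : Fin R) (j j' : Fin C), (j ∈ C₁ ↔ j' ∈ C₁) ∧ 0 < X (i, j) - Y (i, j) ∧
      X (i, j') - Y (i, j') < 0
  · obtain ⟨i, j, j', hj, h1, h2⟩ := hA
    obtain ⟨X', hs, hd⟩ := caseA R₁ C₁ X Y hX hY hz hj h1 h2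
    exact ⟨X', Relation.ReflTransGen.single hs, hd⟩
  have hblk : ∃ (i i' : Fin R) (j j' : Fin C), (i ∈ R₁ ↔ i' ∈ R₁) ∧ (j ∈ C₁ ↔ j' ∈ C₁) ∧
      0 < X (i, j) - Y (i, j) ∧ X (i', j') - Y (i', j') < 0 := by
    obtain ⟨⟨a, b⟩, hp⟩ := Function.ne_iff.mp hne
    obtain ⟨T, hT, hsum⟩ := block_sum R₁ C₁ _ hz a b
    have hm : (a, b) ∈ T := by simp [hT]
    rcases lt_or_gt_of_ne hp with h | h
    · obtain ⟨⟨c, d⟩, hq, hpos⟩ := exists_pos_of_sum hsum hm (by simpa using h)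
      rw [hT] at hq
      exact ⟨c, a, d, b, hq.1, hq.2, hpos, by omega⟩
    · obtain ⟨⟨c, d⟩, hq, hneg⟩ := exists_neg_of_sum hsum hm (by simpa using h)
      rw [hT] at hq
      exact ⟨a, c, b, d, hq.1.symm, hq.2.symm, by omega, hneg⟩
  obtain ⟨i, i', j, j', hi, hj, h1, h2⟩ := hblk
  have hii : i ≠ i' := by
    rintro rfl
    exact hA ⟨i, j, j', hj, h1, h2⟩
  obtain ⟨j1, -, h3⟩ := exists_neg_of_sum (hz.1 i) (Finset.mem_univ j) (by simpa using h1)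
  obtain ⟨j2, -, h4⟩ := exists_pos_of_sum (hz.1 i') (Finset.mem_univ j') (by simpa using h2)
  simp only [Pi.sub_apply] at h3 h4
  have hj1 : ¬ (j ∈ C₁ ↔ j1 ∈ C₁) := fun h => hA ⟨i, j, j1, h, h1, h3⟩
  have hj2 : ¬ (j2 ∈ C₁ ↔ j' ∈ C₁) := fun h => hA ⟨i', j2, j', h, h4, h2⟩
  have hj12 : j2 ∈ C₁ ↔ j1 ∈ C₁ := by tauto
  have hne2 : j2 ≠ j := by rintro rfl; exact hj2 hj
  have y1 := hY (i, j)
  have y2 := hY (i', j2)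
  have hs := step_basic R₁ C₁ X hX hii hne2 (Or.inl hi) (by omega) (by omega)
  have hd := dist1_basic X Y hii hne2
  by_cases h5 : X (i, j2) - Y (i, j2) < 0
  · refine ⟨_, Relation.ReflTransGen.single hs, ?_⟩
    rw [hd]
    simp only [abs_eq_max_neg]
    omega
  · have hj12' : j1 ≠ j2 := by rintro rfl; exact h5 h3
    have hj1j : j1 ≠ j := by rintro rfl; exact hj1 Iff.rfl
    have hX' : ∀ p, 0 ≤ (X + basicMove i i' j2 j) p := by
      obtain ⟨B, _, hB, h0⟩ := hs
      exact h0
    obtain ⟨X'', hs', hd'⟩ := caseA R₁ C₁ _ Y hX' hY (isMove_of_step hs hz) (i := i) hj12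
      (by simp [basicMove, hii, hne2]; omega)
      (by simp [basicMove, hii, hj12', hj1j]; omega)
    refine ⟨X'', (Relation.ReflTransGen.single hs).tail hs', lt_of_lt_of_le hd' ?_⟩
    rw [hd]
    simp only [abs_eq_max_neg]
    omega

lemma path_inv {S : Finset (Fin R × Fin C)} {X X' Y : Fin R × Fin C → ℤ}
    (h : Relation.ReflTransGen (Step S) X X') (hX : ∀ p, 0 ≤ X p) (hz : isMove S (X - Y)) :
    (∀ p, 0 ≤ X' p) ∧ isMove S (X' - Y) := by
  induction h with
  | refl => exact ⟨hX, hz⟩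
  | tail _ hs ih =>
    refine ⟨?_, isMove_of_step hs ih.2⟩
    obtain ⟨B, _, _, h0⟩ := hs
    exact h0

lemma connect (R₁ : Finset (Fin R)) (C₁ : Finset (Fin C)) (Y : Fin R × Fin C → ℤ)
    (hY : ∀ p, 0 ≤ Y p) (n : ℕ) : ∀ X : Fin R × Fin C → ℤ, (∀ p, 0 ≤ X p) →
    isMove (R₁ ×ˢ C₁ ∪ R₁ᶜ ×ˢ C₁ᶜ) (X - Y) → dist1 X Y < n →
    Relation.ReflTransGen (Step (R₁ ×ˢ C₁ ∪ R₁ᶜ ×ˢ C₁ᶜ)) X Y := by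
  induction n with
  | zero =>
    intro X _ _ h
    have : 0 ≤ dist1 X Y := Finset.sum_nonneg fun _ _ => abs_nonneg _
    simp at h
    omega
  | succ n ih =>
    intro X hX hz h
    by_cases hne : X = Y
    · subst hne; exact Relation.ReflTransGen.refl
    obtain ⟨X', hp, hd⟩ := reduce R₁ C₁ X Y hX hY hz hne
    obtain ⟨hX', hz'⟩ := path_inv hp hX hz
    exact hp.trans (ih X' hX' hz' (by push_cast at h; omega))

lemma path_seq {S : Finset (Fin R × Fin C)} {X Y : Fin R × Fin C → ℤ}
    (h : Relation.ReflTransGen (Step S) X Y) :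
    ∃ (α : ℕ) (B : ℕ → (Fin R × Fin C → ℤ)), (∀ t < α, B t ∈ B0 S) ∧
      (∀ p, Y p = X p + ∑ t ∈ Finset.range α, B t p) ∧
      (∀ a, 1 ≤ a → a ≤ α → ∀ p, 0 ≤ X p + ∑ t ∈ Finset.range a, B t p) := by
  induction h with
  | refl => exact ⟨0, fun _ => 0, by simp, by simp, fun a h1 h2 => by omega⟩
  | @tail Z W _ hs ih =>
    obtain ⟨α, B, hB, hsum, hnn⟩ := ih
    obtain ⟨D, hD, rfl, h0⟩ := hs
    have hlow : ∀ a ≤ α, ∀ p, ∑ t ∈ Finset.range a, (if t < α then B t else D) p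
        = ∑ t ∈ Finset.range a, B t p := by
      intro a ha p
      refine Finset.sum_congr rfl fun t ht => ?_
      rw [if_pos (lt_of_lt_of_le (Finset.mem_range.mp ht) ha)]
    have htop : ∀ p, (Z + D) p
        = X p + ∑ t ∈ Finset.range (α + 1), (if t < α then B t else D) p := by
      intro p
      rw [Finset.sum_range_succ, hlow α le_rfl]
      simp [hsum p, add_assoc]
    refine ⟨α + 1, fun t => if t < α then B t else D, fun t _ => ?_, htop, fun a h1 h2 p => ?_⟩
    · by_cases h : t < α
      · simpa [h] using hB t h
      · simpa [h] using hD
    · rcases Nat.lt_or_ge α a with h | h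
      · obtain rfl : a = α + 1 := by omega
        rw [← htop]; exact h0 p
      · simp only [hlow a h]
        exact hnn a h1 h p

lemma basicMove_neg (i i' : Fin R) (j j' : Fin C) :
    - basicMove i i' j j' = basicMove i i' j' j := by
  funext p
  simp only [basicMove, Pi.neg_apply]
  ring

end BlockDiagAux

open BlockDiagAux in
/-- Proposition 3: if `S` is equivalent to a 2×2 block diagonal set, then `B₀(S)` is a
Markov basis for `S`. -/
theorem stmt9 {R C : ℕ} (hR : 1 ≤ R) (hC : 1 ≤ C) (S : Finset (Fin R × Fin C))
    (hS : isBlockDiag S) : isMarkovBasis S (B0 S) := by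
  obtain ⟨R₁, C₁, -, -, -, -, rfl⟩ := hS
  refine ⟨?_, ?_, ?_, ?_⟩
  · refine (Set.finite_range (fun q : (Fin R × Fin R) × (Fin C × Fin C) =>
      basicMove q.1.1 q.1.2 q.2.1 q.2.2)).subset ?_
    rintro z ⟨i, i', j, j', -, -, rfl, -⟩
    exact ⟨((i, i'), (j, j')), rfl⟩
  · rintro z ⟨i, i', j, j', -, -, -, h⟩
    exact h
  · rintro z ⟨i, i', j, j', hi, hj, rfl, h⟩
    refine ⟨i, i', j', j, hi, hj.symm, basicMove_neg _ _ _ _, ?_⟩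
    obtain ⟨a, b, c⟩ := h
    exact ⟨fun k => by simp [a k], fun k => by simp [b k], by
      simp only [Pi.neg_apply, Finset.sum_neg_distrib, c, neg_zero]⟩
  · intro x y hf hne
    have hz : isMove (R₁ ×ˢ C₁ ∪ R₁ᶜ ×ˢ C₁ᶜ)
        ((fun p => (x p : ℤ)) - (fun p => (y p : ℤ))) := by
      obtain ⟨a, b, c⟩ := hf
      refine ⟨fun i => ?_, fun j => ?_, ?_⟩ <;>
        simp only [Pi.sub_apply, Finset.sum_sub_distrib, sub_eq_zero]
      · exact_mod_cast a i
      · exact_mod_cast b j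
      · exact_mod_cast c
    have hp := connect R₁ C₁ (fun p => (y p : ℤ)) (fun p => by positivity)
      ((dist1 (fun p => (x p : ℤ)) (fun p => (y p : ℤ))).toNat + 1) (fun p => (x p : ℤ))
      (fun p => by positivity) hz (by push_cast; omega)
    obtain ⟨α, B, hB, hsum, hnn⟩ := path_seq hp
    refine ⟨α, B, ?_, hB, hsum, hnn⟩
    rcases Nat.eq_zero_or_pos α with h | h
    · subst h
      exfalso
      apply hne
      funext p
      have := hsum p
      simp at this
      exact this.symm
    · exact h
end

section
/- Let n ≥ 1, R = n, C = n + 1, and let S = {(i,j) ∈ I : j ≤ i} be the staircase set (an n×(n+1) triangular set all of whose blocks are single cells). Then B₀(S) is a Markov basis for S. -/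
open Finset

/-- Clockwise arc length from column `j` to row `i`. -/
def arcLen {n : ℕ} (p : Fin n × Fin (n + 1)) : ℤ :=
  2 * (p.1 : ℤ) + 1 - 2 * (p.2 : ℤ) + (if (p.2 : ℕ) ≤ (p.1 : ℕ) then 0 else 2 * (n : ℤ) + 1)

/-- Weight: `1` for arcs containing the arc of `p0`, `-1` for arcs strictly inside. -/
def wt {n : ℕ} (p0 p : Fin n × Fin (n + 1)) : ℤ :=
  (if (p.2 : ℕ) ≤ (p0.2 : ℕ) then 1 else 0) + (if (p0.1 : ℕ) ≤ (p.1 : ℕ) then 1 else 0)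
    - (if (p.2 : ℕ) ≤ (p.1 : ℕ) then 1 else 0) - (if (p0.2 : ℕ) ≤ (p0.1 : ℕ) then 0 else 1)

def pot {n : ℕ} (x : Fin n × Fin (n + 1) → ℕ) : ℤ := ∑ p, (x p : ℤ) * arcLen p ^ 2

def stepRel {R C : ℕ} (S : Finset (Fin R × Fin C)) (x y : Fin R × Fin C → ℕ) : Prop :=
  ∃ b ∈ B0 S, ∀ p, (y p : ℤ) = (x p : ℤ) + b p

lemma basicMove_sum_mul {R C : ℕ} (i i' : Fin R) (j j' : Fin C) (f : Fin R × Fin C → ℤ) :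
    ∑ p, basicMove i i' j j' p * f p = f (i, j) + f (i', j') - f (i, j') - f (i', j) := by
  simp only [basicMove, sub_mul, add_mul, ite_mul, one_mul, zero_mul, sum_sub_distrib,
    sum_add_distrib, sum_ite_eq', sum_ite_eq, mem_univ, if_true]

lemma basicMove_isMove {R C : ℕ} (S : Finset (Fin R × Fin C)) (i i' : Fin R) (j j' : Fin C)
    (h : (if (i, j) ∈ S then 1 else 0) + (if (i', j') ∈ S then 1 else 0)
      - (if (i, j') ∈ S then 1 else 0) - (if (i', j) ∈ S then (1 : ℤ) else 0) = 0) :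
    isMove S (basicMove i i' j j') := by
  refine ⟨fun a => ?_, fun a => ?_, ?_⟩
  · simp only [basicMove, Prod.mk.injEq, ite_and, sum_sub_distrib, sum_add_distrib]
    by_cases h1 : a = i <;> by_cases h2 : a = i' <;> simp [h1, h2]
  · simp only [basicMove, Prod.mk.injEq, and_comm (a := _ = i), and_comm (a := _ = i'), ite_and,
      sum_sub_distrib, sum_add_distrib]
    by_cases h1 : a = j <;> by_cases h2 : a = j' <;> simp [h1, h2]
  · simp only [basicMove, sum_sub_distrib, sum_add_distrib, sum_ite_eq', sum_ite_eq]
    exact h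

lemma isMove_neg {R C : ℕ} {S : Finset (Fin R × Fin C)} {z : Fin R × Fin C → ℤ}
    (h : isMove S z) : isMove S (-z) := by
  obtain ⟨h1, h2, h3⟩ := h
  refine ⟨fun a => ?_, fun a => ?_, ?_⟩
  · simp [h1 a]
  · simp [h2 a]
  · simp [h3]

lemma B0_neg {R C : ℕ} {S : Finset (Fin R × Fin C)} {z : Fin R × Fin C → ℤ}
    (h : z ∈ B0 S) : -z ∈ B0 S := by
  obtain ⟨i, i', j, j', hi, hj, rfl, hm⟩ := h
  refine ⟨i, i', j', j, hi, hj.symm, ?_, isMove_neg hm⟩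
  funext p
  simp only [basicMove, Pi.neg_apply]
  ring

lemma B0_finite {R C : ℕ} (S : Finset (Fin R × Fin C)) : (B0 S).Finite := by
  refine (Set.finite_range (fun q : (Fin R × Fin R) × (Fin C × Fin C) =>
    basicMove q.1.1 q.1.2 q.2.1 q.2.2)).subset ?_
  rintro z ⟨i, i', j, j', _, _, rfl, _⟩
  exact ⟨((i, i'), (j, j')), rfl⟩

lemma stepRel_symm {R C : ℕ} {S : Finset (Fin R × Fin C)} {x y : Fin R × Fin C → ℕ}
    (h : stepRel S x y) : stepRel S y x := by
  obtain ⟨b, hb, h⟩ := h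
  refine ⟨-b, B0_neg hb, fun p => ?_⟩
  have := h p
  simp only [Pi.neg_apply]
  linarith

lemma sameFiber_symm {R C : ℕ} {S : Finset (Fin R × Fin C)} {x y : Fin R × Fin C → ℕ}
    (h : sameFiber S x y) : sameFiber S y x :=
  ⟨fun i => (h.1 i).symm, fun j => (h.2.1 j).symm, h.2.2.symm⟩

lemma sameFiber_trans {R C : ℕ} {S : Finset (Fin R × Fin C)} {x y w : Fin R × Fin C → ℕ}
    (h : sameFiber S x y) (h' : sameFiber S y w) : sameFiber S x w :=
  ⟨fun i => (h.1 i).trans (h'.1 i), fun j => (h.2.1 j).trans (h'.2.1 j), h.2.2.trans h'.2.2⟩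

lemma stepRel_sameFiber {R C : ℕ} {S : Finset (Fin R × Fin C)} {x y : Fin R × Fin C → ℕ}
    (h : stepRel S x y) : sameFiber S x y := by
  obtain ⟨b, ⟨i, i', j, j', _, _, _, h1, h2, h3⟩, h⟩ := h
  refine ⟨fun a => ?_, fun a => ?_, ?_⟩
  · have : (∑ j, (x (a, j) : ℤ)) = ∑ j, (y (a, j) : ℤ) := by
      simp only [h, sum_add_distrib, h1 a, add_zero]
    exact_mod_cast this
  · have : (∑ i, (x (i, a) : ℤ)) = ∑ i, (y (i, a) : ℤ) := by
      simp only [h, sum_add_distrib, h2 a, add_zero]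
    exact_mod_cast this
  · have : (∑ p ∈ S, (x p : ℤ)) = ∑ p ∈ S, (y p : ℤ) := by
      simp only [h, sum_add_distrib, h3, add_zero]
    exact_mod_cast this

/-- Swapping strictly nested arcs decreases the potential. -/
lemma exists_step {n : ℕ} (x : Fin n × Fin (n + 1) → ℕ) (p q : Fin n × Fin (n + 1))
    (hw : wt p q < 0) (hp : 0 < x p) (hq : 0 < x q) :
    ∃ x', stepRel (staircase n) x x' ∧ pot x' < pot x := by
  obtain ⟨i0, j0⟩ := p
  obtain ⟨i, j⟩ := q
  have hi0 := i0.isLt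
  have hi := i.isLt
  have hj0 := j0.isLt
  have hj := j.isLt
  have hne : i0 ≠ i ∧ j ≠ j0 := by
    simp only [wt] at hw
    constructor <;> intro h <;> subst h <;> split_ifs at hw <;> omega
  have hmove : isMove (staircase n) (basicMove i0 i j j0) := by
    apply basicMove_isMove
    simp only [wt] at hw
    simp only [staircase, mem_filter, mem_univ, true_and]
    split_ifs at hw ⊢ <;> omega
  have hnn : ∀ r, 0 ≤ (x r : ℤ) + basicMove i0 i j j0 r := by
    intro r
    have h1 : r = (i0, j0) → 0 < x r := by rintro rfl; exact hp
    have h2 : r = (i, j) → 0 < x r := by rintro rfl; exact hq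
    have h3 : ¬ (r = (i0, j0) ∧ r = (i, j)) := by
      rintro ⟨h, h'⟩
      rw [h] at h'
      exact hne.1 (Prod.mk.inj h').1
    simp only [basicMove]
    by_cases a : r = (i0, j0) <;> by_cases b : r = (i, j)
    · exact absurd ⟨a, b⟩ h3
    · have := h1 a
      rw [if_pos a, if_neg b]
      split_ifs <;> omega
    · have := h2 b
      rw [if_neg a, if_pos b]
      split_ifs <;> omega
    · rw [if_neg a, if_neg b]
      split_ifs <;> omega
  refine ⟨fun r => ((x r : ℤ) + basicMove i0 i j j0 r).toNat,
    ⟨_, ⟨i0, i, j, j0, hne.1, hne.2, rfl, hmove⟩, fun r => Int.toNat_of_nonneg (hnn r)⟩, ?_⟩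
  simp only [pot, Int.toNat_of_nonneg (hnn _), add_mul, sum_add_distrib, basicMove_sum_mul]
  suffices h : arcLen (i0, j) ^ 2 + arcLen (i, j0) ^ 2 - arcLen (i0, j0) ^ 2
      - arcLen (i, j) ^ 2 < 0 by linarith
  have key : arcLen (i0, j) + arcLen (i, j0) = arcLen (i0, j0) + arcLen (i, j) ∧
      arcLen (i, j0) < arcLen (i0, j0) ∧ arcLen (i, j) < arcLen (i, j0) := by
    simp only [wt] at hw
    simp only [arcLen]
    split_ifs at hw ⊢ <;> omega
  obtain ⟨k1, k2, k3⟩ := key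
  have e : arcLen (i0, j) = arcLen (i0, j0) + arcLen (i, j) - arcLen (i, j0) := by linarith
  rw [e]
  nlinarith [mul_pos (sub_pos.2 k2) (sub_pos.2 k3)]

lemma wt_sum {n : ℕ} (x y : Fin n × Fin (n + 1) → ℕ) (h : sameFiber (staircase n) x y)
    (p0 : Fin n × Fin (n + 1)) : ∑ p, wt p0 p * ((x p : ℤ) - y p) = 0 := by
  obtain ⟨h1, h2, h3⟩ := h
  have r : ∀ i, ∑ j, ((x (i, j) : ℤ) - y (i, j)) = 0 := fun i => by
    rw [sum_sub_distrib, sub_eq_zero]; exact_mod_cast h1 i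
  have c : ∀ j, ∑ i, ((x (i, j) : ℤ) - y (i, j)) = 0 := fun j => by
    rw [sum_sub_distrib, sub_eq_zero]; exact_mod_cast h2 j
  have s : ∑ p ∈ staircase n, ((x p : ℤ) - y p) = 0 := by
    rw [sum_sub_distrib, sub_eq_zero]; exact_mod_cast h3
  simp only [wt, sub_mul, add_mul, sum_sub_distrib (f := fun _ => _ - _),
    sum_sub_distrib, sum_add_distrib]
  have e1 : ∑ p : Fin n × Fin (n + 1),
      (if (p.2 : ℕ) ≤ (p0.2 : ℕ) then (1 : ℤ) else 0) * ((x p : ℤ) - y p) = 0 := by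
    rw [Fintype.sum_prod_type_right]
    refine sum_eq_zero fun j _ => ?_
    by_cases hc : (j : ℕ) ≤ (p0.2 : ℕ)
    · simp only [hc, if_true, one_mul, c]
    · simp only [hc, if_false, zero_mul, sum_const_zero]
  have e2 : ∑ p : Fin n × Fin (n + 1),
      (if (p0.1 : ℕ) ≤ (p.1 : ℕ) then (1 : ℤ) else 0) * ((x p : ℤ) - y p) = 0 := by
    rw [Fintype.sum_prod_type]
    refine sum_eq_zero fun j _ => ?_
    by_cases hc : (p0.1 : ℕ) ≤ (j : ℕ)
    · simp only [hc, if_true, one_mul, r]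
    · simp only [hc, if_false, zero_mul, sum_const_zero]
  have e3 : ∑ p : Fin n × Fin (n + 1),
      (if (p.2 : ℕ) ≤ (p.1 : ℕ) then (1 : ℤ) else 0) * ((x p : ℤ) - y p) = 0 := by
    simp only [ite_mul, one_mul, zero_mul]
    rw [← sum_filter]
    exact s
  have e4 : ∑ p : Fin n × Fin (n + 1),
      (if (p0.2 : ℕ) ≤ (p0.1 : ℕ) then (0 : ℤ) else 1) * ((x p : ℤ) - y p) = 0 := by
    rw [← mul_sum, Fintype.sum_prod_type, sum_eq_zero fun i _ => r i, mul_zero]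
  rw [e1, e2, e3, e4]
  rfl

lemma exists_nested {n : ℕ} (x y : Fin n × Fin (n + 1) → ℕ) (h : sameFiber (staircase n) x y)
    (p : Fin n × Fin (n + 1)) (hp : y p < x p)
    (hmax : ∀ q, arcLen p < arcLen q → x q = y q) :
    ∃ q, wt p q < 0 ∧ 0 < x q := by
  by_contra hcon
  push Not at hcon
  have hs := wt_sum x y h p
  have hle : ∑ q, (if q = p then ((x p : ℤ) - y p) else 0) ≤ ∑ q, wt p q * ((x q : ℤ) - y q) := by
    refine sum_le_sum fun q _ => ?_
    by_cases hqp : q = p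
    · subst hqp
      rw [if_pos rfl]
      have : wt q q = 1 := by
        simp only [wt]
        split_ifs <;> omega
      rw [this, one_mul]
    · rw [if_neg hqp]
      rcases lt_trichotomy (wt p q) 0 with hw | hw | hw
      · have := hcon q hw
        apply mul_nonneg_of_nonpos_of_nonpos hw.le
        omega
      · rw [hw, zero_mul]
      · have hl : arcLen p < arcLen q := by
          obtain ⟨i0, j0⟩ := p
          obtain ⟨i, j⟩ := q
          have hi0 := i0.isLt
          have hi := i.isLt
          have hj0 := j0.isLt
          have hj := j.isLt
          have hne : ¬ ((i : ℕ) = i0 ∧ (j : ℕ) = j0) := by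
            rintro ⟨a, b⟩
            exact hqp (by rw [Fin.ext a, Fin.ext b])
          simp only [wt] at hw
          simp only [arcLen]
          split_ifs at hw ⊢ <;> omega
        rw [hmax q hl]
        simp
  rw [hs, sum_ite_eq'] at hle
  simp only [mem_univ, if_true] at hle
  omega

lemma exists_reduce {n : ℕ} (x y : Fin n × Fin (n + 1) → ℕ) (h : sameFiber (staircase n) x y)
    (hxy : x ≠ y) :
    (∃ x', stepRel (staircase n) x x' ∧ pot x' < pot x) ∨
    (∃ y', stepRel (staircase n) y y' ∧ pot y' < pot y) := by
  have hne : (univ.filter fun q => x q ≠ y q).Nonempty := by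
    obtain ⟨q, hq⟩ := Function.ne_iff.1 hxy
    exact ⟨q, by simpa using hq⟩
  obtain ⟨p, hp, hmax⟩ := exists_max_image _ arcLen hne
  have hp' : x p ≠ y p := by simpa using hp
  have hm : ∀ q, arcLen p < arcLen q → x q = y q := by
    intro q hq
    by_contra hc
    exact absurd (hmax q (by simpa using hc)) (not_le.2 hq)
  rcases lt_or_gt_of_ne hp' with hlt | hlt
  · obtain ⟨q, hw, hq⟩ := exists_nested y x (sameFiber_symm h) p hlt fun q hq => (hm q hq).symm
    exact Or.inr (exists_step y p q hw (by omega) hq)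
  · obtain ⟨q, hw, hq⟩ := exists_nested x y h p hlt hm
    exact Or.inl (exists_step x p q hw (by omega) hq)

lemma pot_nonneg {n : ℕ} (x : Fin n × Fin (n + 1) → ℕ) : 0 ≤ pot x :=
  sum_nonneg fun p _ => by positivity

lemma connected_s10 {n : ℕ} (N : ℕ) : ∀ x y : Fin n × Fin (n + 1) → ℕ,
    sameFiber (staircase n) x y → pot x + pot y < N →
    Relation.ReflTransGen (stepRel (staircase n)) x y := by
  induction N with
  | zero =>
    intro x y _ h
    have := pot_nonneg x
    have := pot_nonneg y
    push_cast at h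
    omega
  | succ N ih =>
    intro x y hf hN
    push_cast at hN
    by_cases hxy : x = y
    · rw [hxy]
    rcases exists_reduce x y hf hxy with ⟨x', hs, hlt⟩ | ⟨y', hs, hlt⟩
    · exact Relation.ReflTransGen.head hs
        (ih x' y (sameFiber_trans (sameFiber_symm (stepRel_sameFiber hs)) hf) (by omega))
    · exact Relation.ReflTransGen.tail
        (ih x y' (sameFiber_trans hf (stepRel_sameFiber hs)) (by omega)) (stepRel_symm hs)

lemma path_of_rel {R C : ℕ} {S : Finset (Fin R × Fin C)} {x y : Fin R × Fin C → ℕ}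
    (h : Relation.ReflTransGen (stepRel S) x y) :
    ∃ (α : ℕ) (B : ℕ → (Fin R × Fin C → ℤ)),
      (∀ t < α, B t ∈ B0 S) ∧
      (∀ p, (y p : ℤ) = (x p : ℤ) + ∑ t ∈ Finset.range α, B t p) ∧
      (∀ a, a ≤ α → ∀ p, 0 ≤ (x p : ℤ) + ∑ t ∈ Finset.range a, B t p) := by
  induction h with
  | refl => exact ⟨0, fun _ => 0, by simp, by simp, by simp⟩
  | @tail y w _ hs ih =>
    obtain ⟨α, B, h1, h2, h3⟩ := ih
    obtain ⟨b, hb, hbw⟩ := hs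
    have hsum : ∀ a ≤ α, ∀ p, ∑ t ∈ range a, (if t = α then b else B t) p
        = ∑ t ∈ range a, B t p := by
      intro a ha p
      refine sum_congr rfl fun t ht => ?_
      have := mem_range.1 ht
      rw [if_neg (by omega)]
    have hfin : ∀ p, (w p : ℤ) = (x p : ℤ)
        + ∑ t ∈ range (α + 1), (if t = α then b else B t) p := by
      intro p
      rw [sum_range_succ, hsum α le_rfl, if_pos rfl, hbw, h2]
      ring
    refine ⟨α + 1, fun t => if t = α then b else B t, ?_, hfin, ?_⟩
    · intro t ht
      by_cases e : t = α
      · simpa [e] using hb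
      · simpa [e] using h1 t (by omega)
    · intro a ha p
      rcases Nat.lt_or_ge α a with hlt | hge
      · have : a = α + 1 := by omega
        subst this
        have := hfin p
        simp only at this ⊢
        omega
      · have := h3 a hge p
        rw [← hsum a hge p] at this
        exact this

/-- Proposition 4: for the `n × (n+1)` staircase set (a triangular set all of whose blocks
are single cells), `B₀(S)` is a Markov basis for `S`. -/
theorem stmt10 (n : ℕ) (hn : 1 ≤ n) :
    isMarkovBasis (staircase n) (B0 (staircase n)) := by
  refine ⟨B0_finite _, ?_, fun z hz => B0_neg hz, ?_⟩
  · rintro z ⟨i, i', j, j', _, _, _, hm⟩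
    exact hm
  · intro x y hf hxy
    have hpos := add_nonneg (pot_nonneg x) (pot_nonneg y)
    obtain ⟨α, B, h1, h2, h3⟩ := path_of_rel
      (connected_s10 ((pot x + pot y).toNat + 1) x y hf (by push_cast; omega))
    refine ⟨α, B, ?_, h1, h2, fun a _ ha => h3 a ha⟩
    rcases Nat.eq_zero_or_pos α with h0 | h0
    · subst h0
      exfalso
      apply hxy
      funext p
      have := h2 p
      simp only [range_zero, sum_empty, add_zero] at this
      exact_mod_cast this.symm
    · exact h0
end
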